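/- arXiv:2304.03484 — 3 statements merged into one kernel-verified Lean document; each statement's English description precedes it below -/
import Mathlib

section
/- There is an absolute constant C > 0 such that for every integer h ≥ 1, every real Δ > 0, and every polygonal domain P = P₀ \ ⋃_{i=1}^h interior(Pᵢ) in 𝒞(h) in which every hole satisfies diam₂(Pᵢ) ≤ Δ·diam₂(P), and every point s ∈ P, there exists a continuous path γ : [0,1] → ℝ² with γ(0) = s, γ(1) ∈ frontier(P₀), image of γ contained in P, and length at most C·(1 + h^{3/4}·Δ)·diam₂(P). -/
open Set Metric ENNReal RealInnerProductSpace

noncomputable section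

/-- The Euclidean plane. -/
abbrev Plane := EuclideanSpace ℝ (Fin 2)

/-- A convex polygon: the convex hull of a nonempty finite point set. -/
def IsConvexPolygon (Q : Set Plane) : Prop :=
  ∃ S : Finset Plane, S.Nonempty ∧ Q = convexHull ℝ (S : Set Plane)

/-- `γ` is a continuous path from `s` to `t` (parametrized on `[0,1]`) with image in `P`. -/
def IsPathIn (P : Set Plane) (γ : ℝ → Plane) (s t : Plane) : Prop :=
  ContinuousOn γ (Set.Icc 0 1) ∧ γ 0 = s ∧ γ 1 = t ∧ Set.MapsTo γ (Set.Icc 0 1) P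

/-- Length of a path: its total variation on `[0,1]`. -/
def pathLen (γ : ℝ → Plane) : ℝ≥0∞ := eVariationOn γ (Set.Icc 0 1)

/-- Geodesic distance inside `P`: infimum of lengths of continuous paths
from `s` to `t` contained in `P`. -/
def geod (P : Set Plane) (s t : Plane) : ℝ≥0∞ :=
  ⨅ γ : {γ : ℝ → Plane // IsPathIn P γ s t}, pathLen γ.1

/-- Geodesic diameter of `P`. -/
def geodDiam (P : Set Plane) : ℝ≥0∞ :=
  ⨆ s ∈ P, ⨆ t ∈ P, geod P s t

/-- The width of a planar set: the minimum, over unit directions `v`,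
of the extent of `C` in direction `v`. -/
def setWidth (C : Set Plane) : ℝ :=
  ⨅ v : {v : Plane // ‖v‖ = 1},
    (sSup ((fun x => ⟪x, v.1⟫) '' C) - sInf ((fun x => ⟪x, v.1⟫) '' C))

/-- `ReachWithin S a b ℓ`: the points `a` and `b` are joined inside `S` by a curve of length
at most `ℓ`, given by a `1`-Lipschitz parametrization on `[0, ℓ]`. -/
def ReachWithin (S : Set Plane) (a b : Plane) (ℓ : ℝ) : Prop :=
  0 ≤ ℓ ∧ ∃ γ : ℝ → Plane, γ 0 = a ∧ γ ℓ = b ∧ (∀ t ∈ Icc 0 ℓ, γ t ∈ S) ∧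
    ∀ t, 0 ≤ t → ∀ t', t ≤ t' → t' ≤ ℓ → dist (γ t) (γ t') ≤ t' - t

theorem lipschitzOnWith_of_dist_le {γ : ℝ → Plane} {ℓ : ℝ}
    (hL : ∀ t, 0 ≤ t → ∀ t', t ≤ t' → t' ≤ ℓ → dist (γ t) (γ t') ≤ t' - t) :
    LipschitzOnWith 1 γ (Icc 0 ℓ) := by
  refine LipschitzOnWith.of_dist_le_mul fun t ht t' ht' => ?_
  rw [NNReal.coe_one, one_mul, Real.dist_eq]
  rcases le_total t t' with h | h
  · rw [abs_sub_comm, abs_of_nonneg (sub_nonneg.2 h)]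
    exact hL t ht.1 t' h ht'.2
  · rw [dist_comm, abs_of_nonneg (sub_nonneg.2 h)]
    exact hL t' ht'.1 t h ht.2

namespace ReachWithin

variable {S T : Set Plane} {a b c : Plane} {ℓ ℓ' : ℝ}

theorem mono_set (h : ReachWithin S a b ℓ) (hST : S ⊆ T) : ReachWithin T a b ℓ := by
  obtain ⟨h0, γ, ha, hb, hS, hL⟩ := h
  exact ⟨h0, γ, ha, hb, fun t ht => hST (hS t ht), hL⟩

theorem mono_len (h : ReachWithin S a b ℓ) (hl : ℓ ≤ ℓ') : ReachWithin S a b ℓ' := by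
  obtain ⟨h0, γ, ha, hb, hS, hL⟩ := h
  refine ⟨h0.trans hl, fun t => γ (min t ℓ), by simp [h0, ha], by simp [hl, hb],
    fun t ht => hS _ ⟨le_min ht.1 h0, min_le_right _ _⟩, fun t ht t' htt' ht' => ?_⟩
  refine (hL _ (le_min ht h0) _ (min_le_min_right _ htt') (min_le_right _ _)).trans ?_
  rcases le_total t ℓ with h1 | h1 <;> rcases le_total t' ℓ with h2 | h2 <;> simp [h1, h2] <;>
    linarith

theorem symm (h : ReachWithin S a b ℓ) : ReachWithin S b a ℓ := by
  obtain ⟨h0, γ, ha, hb, hS, hL⟩ := h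
  refine ⟨h0, fun t => γ (ℓ - t), by simp [hb], by simp [ha],
    fun t ht => hS _ ⟨by linarith [ht.2], by linarith [ht.1]⟩, fun t ht t' htt' ht' => ?_⟩
  rw [dist_comm]
  have := hL (ℓ - t') (by linarith) (ℓ - t) (by linarith) (by linarith)
  linarith

theorem trans (h : ReachWithin S a b ℓ) (h' : ReachWithin S b c ℓ') :
    ReachWithin S a c (ℓ + ℓ') := by
  obtain ⟨h0, γ, ha, hb, hS, hL⟩ := h
  obtain ⟨h0', γ', ha', hb', hS', hL'⟩ := h'
  have key : ∀ t, ℓ ≤ t → (if t ≤ ℓ then γ t else γ' (t - ℓ)) = γ' (t - ℓ) := by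
    intro t ht
    split_ifs with h
    · obtain rfl : t = ℓ := le_antisymm h ht
      simp [ha', hb]
    · rfl
  refine ⟨by linarith, fun t => if t ≤ ℓ then γ t else γ' (t - ℓ), by simp [h0, ha], ?_,
    fun t ht => ?_, fun t ht t' htt' ht' => ?_⟩
  · exact (key (ℓ + ℓ') (by linarith)).trans (by rw [add_sub_cancel_left, hb'])
  · dsimp only
    split_ifs with h
    · exact hS t ⟨ht.1, h⟩
    · exact hS' _ ⟨by linarith, by linarith [ht.2]⟩
  · rcases le_total t' ℓ with h2 | h2
    · simp only [if_pos h2, if_pos (htt'.trans h2)]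
      exact hL t ht t' htt' h2
    rcases le_total ℓ t with h1 | h1
    · simp only [key t h1, key t' h2]
      have := hL' (t - ℓ) (by linarith) (t' - ℓ) (by linarith) (by linarith)
      linarith
    · simp only [if_pos h1, key t' h2]
      have e1 := hL t ht ℓ h1 le_rfl
      have e2 := hL' 0 le_rfl (t' - ℓ) (by linarith) (by linarith)
      rw [hb] at e1
      rw [ha'] at e2
      have := dist_triangle (γ t) b (γ' (t' - ℓ))
      linarith

theorem of_segment (h : segment ℝ a b ⊆ S) (hl : dist a b ≤ ℓ) : ReachWithin S a b ℓ := by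
  refine mono_len (ℓ := dist a b) ⟨dist_nonneg, fun t => AffineMap.lineMap a b (t / dist a b),
    by simp, ?_, fun t ht => h ?_, fun t ht t' htt' ht' => ?_⟩ hl
  · rcases eq_or_ne a b with rfl | hab
    · simp
    · simp [div_self (dist_ne_zero.2 hab)]
  · rw [segment_eq_image_lineMap]
    exact ⟨_, ⟨div_nonneg ht.1 dist_nonneg, div_le_one_of_le₀ ht.2 dist_nonneg⟩, rfl⟩
  · rw [dist_lineMap_lineMap, Real.dist_eq, ← sub_div, abs_div, abs_of_nonneg dist_nonneg,
      abs_sub_comm, abs_of_nonneg (sub_nonneg.2 htt')]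
    rcases eq_or_ne (dist a b) 0 with h0 | h0
    · simpa [h0] using htt'
    · rw [div_mul_cancel₀ _ h0]

theorem left_mem (h : ReachWithin S a b ℓ) : a ∈ S := by
  obtain ⟨h0, γ, ha, hb, hS, hL⟩ := h
  exact ha ▸ hS 0 ⟨le_rfl, h0⟩

theorem right_mem (h : ReachWithin S a b ℓ) : b ∈ S := h.symm.left_mem

theorem map {f : Plane → Plane} (h : ReachWithin S a b ℓ) (hf : ∀ x y, dist (f x) (f y) ≤ dist x y)
    (hST : MapsTo f S T) : ReachWithin T (f a) (f b) ℓ := by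
  obtain ⟨h0, γ, ha, hb, hS, hL⟩ := h
  exact ⟨h0, fun t => f (γ t), by simp [ha], by simp [hb], fun t ht => hST (hS t ht),
    fun t ht t' htt' ht' => (hf _ _).trans (hL t ht t' htt' ht')⟩

theorem exists_path (h : ReachWithin S a b ℓ) :
    ∃ γ : ℝ → Plane, IsPathIn S γ a b ∧ pathLen γ ≤ ENNReal.ofReal ℓ := by
  obtain ⟨h0, γ, ha, hb, hS, hL⟩ := h
  have maps : MapsTo (fun t => ℓ * t) (Icc 0 1) (Icc 0 ℓ) := fun t ht =>
    ⟨mul_nonneg h0 ht.1, mul_le_of_le_one_right h0 ht.2⟩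
  have lip := lipschitzOnWith_of_dist_le hL
  have mono : MonotoneOn (fun t => ℓ * t) (Icc 0 1) := fun s _ t _ hst =>
    mul_le_mul_of_nonneg_left hst h0
  refine ⟨fun t => γ (ℓ * t), ⟨lip.continuousOn.comp (by fun_prop) maps, by simp [ha],
    by simp [hb], fun t ht => hS _ (maps ht)⟩, (lip.comp_eVariationOn_le maps).trans ?_⟩
  have := mono.eVariationOn_eq (a := 0) (b := 1) (by simp) (by simp)
  simpa using this.le

theorem exists_coord_eq (h : ReachWithin S a b ℓ) (i : Fin 2) {x : ℝ}
    (hx : x ∈ uIcc (a i) (b i)) : ∃ y, y i = x ∧ ReachWithin S a y ℓ := by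
  obtain ⟨h0, γ, ha, hb, hS, hL⟩ := h
  have lip := lipschitzOnWith_of_dist_le hL
  have cont : ContinuousOn (fun t => γ t i) (uIcc 0 ℓ) := by
    rw [uIcc_of_le h0]
    exact (EuclideanSpace.proj (𝕜 := ℝ) i).continuous.comp_continuousOn lip.continuousOn
  have := intermediate_value_uIcc cont
  rw [ha, hb, uIcc_of_le h0] at this
  obtain ⟨t, ht, rfl⟩ := this hx
  exact ⟨γ t, rfl, mono_len ⟨ht.1, γ, ha, rfl, fun s hs => hS s ⟨hs.1, hs.2.trans ht.2⟩,
    fun s hs s' hss' hs' => hL s hs s' hss' (hs'.trans ht.2)⟩ ht.2⟩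

end ReachWithin

theorem ReachWithin.detour {S T K : Set Plane} {a b : Plane} {ℓ c : ℝ} (h : ReachWithin S a b ℓ)
    (hK : IsClosed K) (ha : a ∉ interior K) (hb : b ∉ interior K) (hc0 : 0 ≤ c)
    (hST : S \ K ⊆ T)
    (hc : ∀ p ∈ S ∩ K, ∀ q ∈ S ∩ K, p ∉ interior K → q ∉ interior K → ReachWithin T p q c) :
    ReachWithin T a b (ℓ + c) := by
  obtain ⟨h0, γ, rfl, rfl, hS, hL⟩ := h
  have cont := (lipschitzOnWith_of_dist_le hL).continuousOn
  have hZ : IsCompact (Icc 0 ℓ ∩ γ ⁻¹' K) :=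
    isCompact_Icc.of_isClosed_subset (cont.preimage_isClosed_of_isClosed isClosed_Icc hK)
      inter_subset_left
  rcases (Icc 0 ℓ ∩ γ ⁻¹' K).eq_empty_or_nonempty with hE | hne
  · refine ReachWithin.mono_len ⟨h0, γ, rfl, rfl, fun t ht => hST ⟨hS t ht, fun hk => ?_⟩, hL⟩
      (by linarith)
    exact (hE ▸ (show t ∈ Icc 0 ℓ ∩ γ ⁻¹' K from ⟨ht, hk⟩) : t ∈ (∅ : Set ℝ))
  obtain ⟨t₁, ⟨ht₁, hk₁⟩, hmin⟩ := hZ.exists_isLeast hne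
  obtain ⟨t₂, ⟨ht₂, hk₂⟩, hmax⟩ := hZ.exists_isGreatest hne
  have near : ∀ t ∈ Icc 0 ℓ, γ t ∈ interior K → ∃ ε > 0, ∀ t' ∈ Icc 0 ℓ, |t' - t| < ε →
      γ t' ∈ K := by
    intro t ht hk
    obtain ⟨ε, hε, hball⟩ := Metric.mem_nhdsWithin_iff.1
      (cont t ht (mem_interior_iff_mem_nhds.1 hk))
    exact ⟨ε, hε, fun t' ht' hd => hball ⟨hd, ht'⟩⟩
  have n₁ : γ t₁ ∉ interior K := by
    intro hk
    obtain ⟨ε, hε, hn⟩ := near t₁ ht₁ hk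
    rcases ht₁.1.eq_or_lt with h | h
    · exact ha (h ▸ hk)
    have hm : max 0 (t₁ - ε / 2) < t₁ := max_lt h (by linarith)
    have hm' := le_max_right 0 (t₁ - ε / 2)
    have hI : max 0 (t₁ - ε / 2) ∈ Icc 0 ℓ := ⟨le_max_left _ _, hm.le.trans ht₁.2⟩
    exact hm.not_ge (hmin ⟨hI, hn _ hI (by rw [abs_lt]; constructor <;> linarith)⟩)
  have n₂ : γ t₂ ∉ interior K := by
    intro hk
    obtain ⟨ε, hε, hn⟩ := near t₂ ht₂ hk
    rcases ht₂.2.eq_or_lt with h | h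
    · exact hb (h ▸ hk)
    have hm : t₂ < min ℓ (t₂ + ε / 2) := lt_min h (by linarith)
    have hm' := min_le_right ℓ (t₂ + ε / 2)
    have hI : min ℓ (t₂ + ε / 2) ∈ Icc 0 ℓ := ⟨ht₂.1.trans hm.le, min_le_left _ _⟩
    exact hm.not_ge (hmax ⟨hI, hn _ hI (by rw [abs_lt]; constructor <;> linarith)⟩)
  have mid := hc _ ⟨hS t₁ ht₁, hk₁⟩ _ ⟨hS t₂ ht₂, hk₂⟩ n₁ n₂
  have first : ReachWithin T (γ 0) (γ t₁) t₁ := by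
    refine ⟨ht₁.1, γ, rfl, rfl, fun t ht => ?_, fun t ht t' htt' ht' =>
      hL t ht t' htt' (ht'.trans ht₁.2)⟩
    have htI : t ∈ Icc 0 ℓ := ⟨ht.1, ht.2.trans ht₁.2⟩
    rcases ht.2.eq_or_lt with h | h
    · exact h ▸ mid.left_mem
    · exact hST ⟨hS t htI, fun hk => h.not_ge (hmin ⟨htI, hk⟩)⟩
  have last : ReachWithin T (γ t₂) (γ ℓ) (ℓ - t₂) := by
    refine ⟨by linarith [ht₂.2], fun t => γ (t + t₂), by simp, by simp, fun t ht => ?_,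
      fun t ht t' htt' ht' => ?_⟩
    · have htI : t + t₂ ∈ Icc 0 ℓ := ⟨by linarith [ht.1, ht₂.1], by linarith [ht.2]⟩
      rcases ht.1.eq_or_lt with h | h
      · simpa [← h] using mid.right_mem
      · exact hST ⟨hS _ htI, fun hk => (show t₂ < t + t₂ by linarith).not_ge (hmax ⟨htI, hk⟩)⟩
    · have := hL (t + t₂) (by linarith [ht₂.1]) (t' + t₂) (by linarith) (by linarith)
      linarith
  have h12 : t₁ ≤ t₂ := hmax ⟨ht₁, hk₁⟩
  exact ((first.trans mid).trans last).mono_len (by linarith)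

theorem exists_proj {K : Set Plane} (hne : K.Nonempty) (hK : IsClosed K) (hcv : Convex ℝ K) :
    ∃ f : Plane → Plane, (∀ x y, dist (f x) (f y) ≤ dist x y) ∧ (∀ x ∈ K, f x = x) ∧
      MapsTo f (interior K)ᶜ (K \ interior K) := by
  have : ∀ x : Plane, ∃ y ∈ K, ∀ k ∈ K, ⟪x - y, k - y⟫ ≤ 0 := by
    intro x
    obtain ⟨y, hy, h⟩ := exists_norm_eq_iInf_of_complete_convex hne hK.isComplete hcv x
    exact ⟨y, hy, (norm_eq_iInf_iff_real_inner_le_zero hcv hy).1 h⟩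
  choose f hf hfk using this
  have fix : ∀ x ∈ K, f x = x := by
    intro x hx
    have := hfk x x hx
    rw [real_inner_self_nonpos, sub_eq_zero] at this
    exact this.symm
  refine ⟨f, fun x y => ?_, fix, fun x hx => ⟨hf x, fun hi => ?_⟩⟩
  · have h1 := hfk x (f y) (hf y)
    have h2 := hfk y (f x) (hf x)
    rw [dist_eq_norm, dist_eq_norm]
    have h3 : ⟪f x - f y, f x - f y⟫ ≤ ⟪x - y, f x - f y⟫ := by
      have e : ⟪x - y, f x - f y⟫ - ⟪f x - f y, f x - f y⟫
          = - ⟪x - f x, f y - f x⟫ - ⟪y - f y, f x - f y⟫ := by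
        simp only [inner_sub_left, inner_sub_right]
        ring
      linarith
    rw [real_inner_self_eq_norm_sq] at h3
    have h4 := real_inner_le_norm (x - y) (f x - f y)
    by_contra! hlt
    have := norm_nonneg (x - y)
    nlinarith
  · have hne' : x - f x ≠ 0 := by
      intro h
      rw [sub_eq_zero] at h
      exact hx (h ▸ hi)
    have hcont : Filter.Tendsto (fun t : ℝ => f x + t • (x - f x)) (nhds 0) (nhds (f x)) := by
      have : Continuous (fun t : ℝ => f x + t • (x - f x)) := by fun_prop
      simpa using this.tendsto 0
    obtain ⟨ε, hε, hball⟩ := Metric.mem_nhds_iff.1 (hcont (mem_interior_iff_mem_nhds.1 hi))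
    have hmem : f x + (ε / 2) • (x - f x) ∈ K :=
      hball (show (ε / 2) ∈ ball (0 : ℝ) ε by simp [abs_of_pos hε, hε])
    have := hfk x _ hmem
    rw [add_sub_cancel_left, inner_smul_right] at this
    have := real_inner_self_pos.2 hne'
    nlinarith

theorem ReachWithin.on_boundary {K : Set Plane} {p q : Plane} {ℓ : ℝ}
    (h : ReachWithin (interior K)ᶜ p q ℓ) (hK : IsClosed K) (hcv : Convex ℝ K) (hp : p ∈ K)
    (hq : q ∈ K) : ReachWithin (K \ interior K) p q ℓ := by
  obtain ⟨f, hf, fix, hm⟩ := exists_proj ⟨p, hp⟩ hK hcv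
  have := h.map hf hm
  rwa [fix p hp, fix q hq] at this

theorem abs_coord_sub_le_dist (a b : Plane) (i : Fin 2) : |a i - b i| ≤ dist a b := by
  have := PiLp.norm_apply_le (a - b) i
  rwa [PiLp.sub_apply, Real.norm_eq_abs, ← dist_eq_norm] at this

theorem dist_le_abs_add_abs (a b : Plane) {i j : Fin 2} (hij : i ≠ j) :
    dist a b ≤ |a i - b i| + |a j - b j| := by
  rw [EuclideanSpace.dist_eq]
  refine Real.sqrt_le_iff.2 ⟨by positivity, ?_⟩
  have : ∑ k, dist (a k) (b k) ^ 2 = |a i - b i| ^ 2 + |a j - b j| ^ 2 := by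
    rw [Fin.sum_univ_two]
    fin_cases i <;> fin_cases j <;> simp_all [Real.dist_eq, add_comm]
  rw [this]
  nlinarith [mul_nonneg (abs_nonneg (a i - b i)) (abs_nonneg (a j - b j))]

theorem plane_ext {a b : Plane} {i j : Fin 2} (hij : i ≠ j) (hi : a i = b i) (hj : a j = b j) :
    a = b := by
  rw [← dist_le_zero]
  simpa [hi, hj] using dist_le_abs_add_abs a b hij

theorem coord_of_mem_segment {a b z : Plane} (hz : z ∈ segment ℝ a b) :
    ∃ s t : ℝ, 0 ≤ s ∧ 0 ≤ t ∧ s + t = 1 ∧ ∀ i, z i = s * a i + t * b i := by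
  obtain ⟨s, t, hs, ht, hst, rfl⟩ := hz
  exact ⟨s, t, hs, ht, hst, fun i => by simp⟩

theorem exists_plane {i j : Fin 2} (hij : i ≠ j) (x y : ℝ) : ∃ z : Plane, z i = x ∧ z j = y := by
  refine ⟨EuclideanSpace.single i x + EuclideanSpace.single j y, ?_, ?_⟩ <;>
    simp [hij, hij.symm]

theorem mem_segment_of_coord {a b z : Plane} {i j : Fin 2} (hij : i ≠ j) (hai : a i = z i)
    (hbi : b i = z i) (h₁ : a j ≤ z j) (h₂ : z j ≤ b j) : z ∈ segment ℝ a b := by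
  have : z j ∈ segment ℝ (a j) (b j) := by
    rw [segment_eq_Icc (h₁.trans h₂)]
    exact ⟨h₁, h₂⟩
  obtain ⟨s, t, hs, ht, hst, hz⟩ := this
  refine ⟨s, t, hs, ht, hst, plane_ext hij ?_ ?_⟩
  · simp only [PiLp.add_apply, PiLp.smul_apply, smul_eq_mul, hai, hbi, ← add_mul, hst, one_mul]
  · simpa using hz

theorem reachWithin_around {K : Set Plane} {p q : Plane} {δ : ℝ} {i j : Fin 2} (hij : i ≠ j)
    (hK : IsClosed K) (hcv : Convex ℝ K) (hδ : 0 < δ) (hd : ∀ x ∈ K, ∀ y ∈ K, dist x y ≤ δ)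
    (hp : p ∈ K) (hq : q ∈ K) (hpi : p ∉ interior K) (hqi : q ∉ interior K) (h : p i = q i) :
    ReachWithin (K \ interior K) p q (13 * δ) := by
  wlog hle : p j ≤ q j generalizing p q
  · exact (this hq hp hqi hpi h.symm (le_of_not_ge hle)).symm
  by_cases hseg : segment ℝ p q ⊆ (interior K)ᶜ
  · exact ReachWithin.of_segment (fun z hz => ⟨hcv.segment_subset hp hq hz, hseg hz⟩)
      (by linarith [hd p hp q hq])
  obtain ⟨c, hc, hcK⟩ := not_subset.1 hseg
  rw [notMem_compl_iff] at hcK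
  obtain ⟨s, t, hs, ht, hst, hcc⟩ := coord_of_mem_segment hc
  have hci : c i = p i := by rw [hcc, ← h, ← add_mul, hst, one_mul]
  obtain rfl : s = 1 - t := by linarith
  have hcj₁ : p j ≤ c j := by rw [hcc]; nlinarith
  have hcj₂ : c j ≤ q j := by rw [hcc]; nlinarith
  have below : ∀ z : Plane, z i = p i → z j ≤ p j → z ∈ (interior K)ᶜ := fun z hz₁ hz₂ hz =>
    hpi (hcv.interior.segment_subset hz hcK (mem_segment_of_coord hij hz₁ hci hz₂ hcj₁))
  have above : ∀ z : Plane, z i = p i → q j ≤ z j → z ∈ (interior K)ᶜ := fun z hz₁ hz₂ hz =>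
    hqi (hcv.interior.segment_subset hcK hz
      (mem_segment_of_coord hij (hci.trans h) (hz₁.trans h) hcj₂ hz₂))
  have far : ∀ k, ∀ z : Plane, 2 * δ ≤ |z k - p k| → z ∈ (interior K)ᶜ := by
    intro k z hz hzK
    have := abs_coord_sub_le_dist z p k
    have := hd z (interior_subset hzK) p hp
    linarith
  have hqp : q j - p j ≤ δ := by
    have := abs_coord_sub_le_dist q p j
    have := hd q hq p hp
    have := le_abs_self (q j - p j)
    linarith
  obtain ⟨c₁, hc₁i, hc₁j⟩ := exists_plane hij (p i) (p j - 2 * δ)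
  obtain ⟨c₂, hc₂i, hc₂j⟩ := exists_plane hij (p i + 2 * δ) (p j - 2 * δ)
  obtain ⟨c₃, hc₃i, hc₃j⟩ := exists_plane hij (p i + 2 * δ) (q j + 2 * δ)
  obtain ⟨c₄, hc₄i, hc₄j⟩ := exists_plane hij (p i) (q j + 2 * δ)
  have hδ2 : |2 * δ| = 2 * δ := abs_of_pos (by linarith)
  have r₁ : ReachWithin (interior K)ᶜ p c₁ (2 * δ) := by
    refine .of_segment (fun z hz => ?_)
      ((dist_le_abs_add_abs _ _ hij).trans (by simp [hc₁i, hc₁j, hδ2]))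
    obtain ⟨s, t, hs, ht, hst, hz⟩ := coord_of_mem_segment hz
    refine below z ?_ ?_
    · rw [hz, hc₁i, ← add_mul, hst, one_mul]
    · rw [hz, hc₁j]
      obtain rfl : s = 1 - t := by linarith
      nlinarith
  have r₂ : ReachWithin (interior K)ᶜ c₁ c₂ (2 * δ) := by
    refine .of_segment (fun z hz => far j z ?_)
      ((dist_le_abs_add_abs _ _ hij).trans (by simp [hc₁i, hc₁j, hc₂i, hc₂j, hδ2]))
    obtain ⟨s, t, hs, ht, hst, hz⟩ := coord_of_mem_segment hz
    rw [hz, hc₁j, hc₂j, ← add_mul, hst, one_mul, sub_sub_cancel_left, abs_neg, hδ2]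
  have r₃ : ReachWithin (interior K)ᶜ c₂ c₃ (5 * δ) := by
    refine .of_segment (fun z hz => far i z ?_) ((dist_le_abs_add_abs _ _ hij).trans ?_)
    · obtain ⟨s, t, hs, ht, hst, hz⟩ := coord_of_mem_segment hz
      rw [hz, hc₂i, hc₃i, ← add_mul, hst, one_mul, add_sub_cancel_left, hδ2]
    · rw [hc₂i, hc₃i, hc₂j, hc₃j, sub_self, abs_zero, abs_of_nonpos (by linarith)]
      linarith
  have r₄ : ReachWithin (interior K)ᶜ c₃ c₄ (2 * δ) := by
    refine .of_segment (fun z hz => far j z ?_)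
      ((dist_le_abs_add_abs _ _ hij).trans (by simp [hc₃i, hc₃j, hc₄i, hc₄j, hδ2]))
    obtain ⟨s, t, hs, ht, hst, hz⟩ := coord_of_mem_segment hz
    rw [hz, hc₃j, hc₄j, ← add_mul, hst, one_mul]
    exact le_trans (by linarith) (le_abs_self _)
  have r₅ : ReachWithin (interior K)ᶜ c₄ q (2 * δ) := by
    refine .of_segment (fun z hz => ?_)
      ((dist_le_abs_add_abs _ _ hij).trans (by simp [h, hc₄i, hc₄j, hδ2]))
    obtain ⟨s, t, hs, ht, hst, hz⟩ := coord_of_mem_segment hz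
    refine above z ?_ ?_
    · rw [hz, hc₄i, ← h, ← add_mul, hst, one_mul]
    · rw [hz, hc₄j]
      obtain rfl : s = 1 - t := by linarith
      nlinarith
  exact ((((r₁.trans r₂).trans r₃).trans r₄).trans r₅).on_boundary hK hcv hp hq |>.mono_len
    (by linarith)

open Classical in
theorem reachWithin_line {ι : Type*} {Q : ι → Set Plane} {a b : Plane} {δ : ℝ} {i j : Fin 2}
    (hij : i ≠ j) (hK : ∀ m, IsClosed (Q m)) (hcv : ∀ m, Convex ℝ (Q m)) (hδ : 0 < δ)
    (hd : ∀ m, ∀ x ∈ Q m, ∀ y ∈ Q m, dist x y ≤ δ) (hdisj : Pairwise (Function.onFun Disjoint Q))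
    (ha : ∀ m, a ∉ interior (Q m)) (hb : ∀ m, b ∉ interior (Q m)) (hab : a i = b i)
    (J : Finset ι) :
    ReachWithin ((segment ℝ a b ∪ ⋃ m ∈ J, Q m) \ ⋃ m ∈ J, interior (Q m)) a b
      (dist a b + 13 * δ * (J.filter fun m => ∃ z ∈ Q m, z i = a i).card) := by
  have hseg : ∀ z ∈ segment ℝ a b, z i = a i := by
    intro z hz
    obtain ⟨s, t, hs, ht, hst, hz⟩ := coord_of_mem_segment hz
    rw [hz, ← hab, ← add_mul, hst, one_mul]
  induction J using Finset.induction_on with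
  | empty => exact .of_segment (by simp) (by simp)
  | insert m J hm ih =>
    have hdm : ∀ z ∈ Q m, ∀ n ∈ J, z ∉ Q n := fun z hz n hn hzn =>
      (hdisj (show m ≠ n by rintro rfl; exact hm hn)).le_bot ⟨hz, hzn⟩
    rw [Finset.filter_insert]
    by_cases hmeet : ∃ z ∈ Q m, z i = a i
    · rw [if_pos hmeet, Finset.card_insert_of_notMem (by simp [hm])]
      push_cast
      rw [mul_add, mul_one, ← add_assoc]
      refine ih.detour (hK m) (ha m) (hb m) (by linarith) ?_ ?_
      · rintro z ⟨⟨hz₁, hz₂⟩, hz₃⟩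
        simp only [Finset.mem_insert, iUnion_iUnion_eq_or_left, mem_sdiff, mem_union, not_or]
        exact ⟨hz₁.imp_right Or.inr, fun h => hz₃ (interior_subset h), hz₂⟩
      · rintro p ⟨⟨hp₁, hp₂⟩, hp⟩ q ⟨⟨hq₁, hq₂⟩, hq⟩ hpi hqi
        have on : ∀ z ∈ Q m, z ∈ segment ℝ a b ∪ ⋃ m ∈ J, Q m → z i = a i := by
          rintro z hz (hz' | hz')
          · exact hseg z hz'
          · simp only [mem_iUnion] at hz'
            obtain ⟨n, hn, hzn⟩ := hz'
            exact absurd hzn (hdm z hz n hn)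
        refine (reachWithin_around hij (hK m) (hcv m) hδ (hd m) hp hq hpi hqi
          ((on p hp hp₁).trans (on q hq hq₁).symm)).mono_set ?_
        rintro z ⟨hz, hzi⟩
        simp only [Finset.mem_insert, iUnion_iUnion_eq_or_left, mem_sdiff, mem_union, not_or,
          mem_iUnion, not_exists]
        exact ⟨Or.inr (Or.inl hz), hzi, fun n hn h => hdm z hz n hn (interior_subset h)⟩
    · rw [if_neg hmeet]
      refine ih.mono_set ?_
      rintro z ⟨hz₁, hz₂⟩
      simp only [Finset.mem_insert, iUnion_iUnion_eq_or_left, mem_sdiff, mem_union, not_or]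
      refine ⟨hz₁.imp_right Or.inr, fun h => ?_, hz₂⟩
      have hzm := interior_subset h
      rcases hz₁ with hz | hz
      · exact hmeet ⟨z, hzm, hseg z hz⟩
      · simp only [mem_iUnion] at hz
        obtain ⟨n, hn, hzn⟩ := hz
        exact hdm z hzm n hn hzn

/-- The height of a point above the line of slope `τ` through the origin. -/
def skewHeight (τ : ℝ) (z : Plane) : ℝ := z 1 - τ * z 0

theorem exists_pos_add_smul_mem_interior {K : Set Plane} {z : Plane} (hz : z ∈ interior K)
    (w : Plane) : ∃ ε : ℝ, 0 < ε ∧ z + ε • w ∈ interior K := by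
  have hcont : Filter.Tendsto (fun t : ℝ => z + t • w) (nhds 0) (nhds z) := by
    have : Continuous (fun t : ℝ => z + t • w) := by fun_prop
    simpa using this.tendsto 0
  obtain ⟨ε, hε, hball⟩ := Metric.mem_nhds_iff.1 (hcont (isOpen_interior.mem_nhds hz))
  exact ⟨ε / 2, by linarith, hball (show (ε / 2) ∈ ball (0 : ℝ) ε by simp [abs_of_pos hε, hε])⟩

theorem slide_cost_bound {M α β Xr Yr Xa Ya Xm Ym : ℝ} (hM : 0 < M) (hα : 0 ≤ α) (hβ : 0 < β)
    (hXr : 0 ≤ Xr) (hr : α * Xr ≤ β * Yr) (ha : α * Xa ≤ β * Ya)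
    (hm : α * Xm ≤ β * Ym) (ha₀ : M * Ya + Xa ≤ 0) (ham : M * Ya + Xa ≤ M * Ym + Xm)
    (hm₀ : M * Ym - Xm ≤ 0) (hmr : M * Ym - Xm ≤ M * Yr - Xr) (hma : M * Ym - Xm ≤ M * Ya - Xa) :
    Xr ≤ M * Yr + (Xm - Xa) := by
  rcases le_or_gt β (M * α) with h | h
  · by_contra! hlt
    have h₁ : M * Yr < Xr := by linarith
    nlinarith [mul_lt_mul_of_pos_left h₁ hβ, mul_le_mul_of_nonneg_left hr hM.le,
      mul_le_mul_of_nonneg_right h hXr]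
  · have e₁ : 0 ≤ Xm := by
      by_contra! hneg
      nlinarith
    have e₂ : 0 ≤ Ym := by
      by_contra! hneg
      nlinarith
    have e₃ : Xa ≤ 0 := by
      by_contra! hpos
      nlinarith [mul_le_mul_of_nonneg_left ha hM.le, mul_le_mul_of_nonneg_left ha₀ hβ.le,
        mul_nonneg (mul_nonneg hM.le hα) hpos.le, mul_pos hβ hpos]
    nlinarith

theorem reachWithin_slide_of_support {K : Set Plane} (hK : IsClosed K) (hcv : Convex ℝ K)
    {p r a m : Plane} {τ M α β ς : ℝ} (hτ₀ : 0 ≤ τ) (hτ₁ : τ ≤ 1) (hM : 0 < M) (hα : 0 ≤ α)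
    (hβ : 0 < β) (hς : |ς| = 1) (hp : p ∈ K)
    (hsup : ∀ k ∈ K, α * (ς * k 0 - ς * p 0) ≤ β * (skewHeight τ k - skewHeight τ p))
    (hsup' : ∀ k ∈ interior K,
      α * (ς * k 0 - ς * p 0) < β * (skewHeight τ k - skewHeight τ p))
    (hrK : r ∈ K) (hr : ∀ k ∈ K, ς * k 0 ≤ ς * r 0)
    (haK : a ∈ K) (ha : ∀ k ∈ K, M * skewHeight τ a + ς * a 0 ≤ M * skewHeight τ k + ς * k 0)
    (hmK : m ∈ K) (hm : ∀ k ∈ K, M * skewHeight τ m - ς * m 0 ≤ M * skewHeight τ k - ς * k 0) :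
    skewHeight τ p ≤ skewHeight τ r ∧
      ReachWithin (K \ interior K) p r
        ((2 * M + 1) * (skewHeight τ r - skewHeight τ p) + 2 * (ς * m 0 - ς * a 0)) := by
  have hpr := hr p hp
  have hY : skewHeight τ p ≤ skewHeight τ r := by
    have := hsup r hrK
    have h₁ : 0 ≤ α * (ς * r 0 - ς * p 0) := mul_nonneg hα (by linarith)
    by_contra! hlt
    nlinarith
  have cost : ς * r 0 - ς * p 0 ≤
      M * (skewHeight τ r - skewHeight τ p) + (ς * m 0 - ς * a 0) := by
    have := slide_cost_bound hM hα hβ (by linarith) (hsup r hrK) (hsup a haK) (hsup m hmK)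
      (by linarith [ha p hp]) (by linarith [ha m hmK]) (by linarith [hm p hp])
      (by linarith [hm r hrK]) (by linarith [hm a haK])
    linarith
  have habs : |r 0 - p 0| = ς * r 0 - ς * p 0 := by
    rw [← mul_sub, ← abs_of_nonneg (by linarith : 0 ≤ ς * (r 0 - p 0)), abs_mul, hς, one_mul]
  obtain ⟨c, hc₀, hc₁⟩ := exists_plane (show (0 : Fin 2) ≠ 1 by simp) (r 0)
    (p 1 + τ * (r 0 - p 0))
  have r₁ : ReachWithin (interior K)ᶜ p c (2 * (ς * r 0 - ς * p 0)) := by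
    refine .of_segment (fun z hz hzK => ?_)
      ((dist_le_abs_add_abs _ _ (show (0 : Fin 2) ≠ 1 by simp)).trans ?_)
    · obtain ⟨s, t, hs, ht, hst, hz⟩ := coord_of_mem_segment hz
      obtain rfl : s = 1 - t := by linarith
      have h₁ := hsup' z hzK
      have h₂ : skewHeight τ z = skewHeight τ p := by
        simp only [skewHeight, hz, hc₀, hc₁]
        ring
      have h₃ : ς * z 0 - ς * p 0 = t * (ς * r 0 - ς * p 0) := by
        rw [hz, hc₀]
        ring
      rw [h₂, h₃, sub_self, mul_zero] at h₁
      exact h₁.not_ge (mul_nonneg hα (mul_nonneg ht (by linarith)))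
    · rw [hc₀, hc₁, sub_add_cancel_left, abs_neg, abs_mul, abs_sub_comm, habs, abs_of_nonneg hτ₀]
      nlinarith
  have r₂ : ReachWithin (interior K)ᶜ c r (skewHeight τ r - skewHeight τ p) := by
    refine .of_segment (fun z hz hzK => ?_)
      ((dist_le_abs_add_abs _ _ (show (0 : Fin 2) ≠ 1 by simp)).trans ?_)
    · obtain ⟨s, t, hs, ht, hst, hz⟩ := coord_of_mem_segment hz
      obtain ⟨ε, hε, hmem⟩ := exists_pos_add_smul_mem_interior hzK (EuclideanSpace.single 0 ς)
      have h₁ := hr _ (interior_subset hmem)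
      have h₂ : z 0 = r 0 := by rw [hz, hc₀, ← add_mul, hst, one_mul]
      have h₃ : ς * ς = 1 := by rw [← abs_mul_abs_self, hς, one_mul]
      have h₄ : (z + ε • EuclideanSpace.single 0 ς : Plane) 0 = z 0 + ε * ς := by simp
      rw [h₄, h₂] at h₁
      nlinarith
    · rw [hc₀, hc₁, sub_self, abs_zero, zero_add, abs_sub_comm]
      have : r 1 - (p 1 + τ * (r 0 - p 0)) = skewHeight τ r - skewHeight τ p := by
        simp only [skewHeight]
        ring
      rw [this, abs_of_nonneg (by linarith)]
  exact ⟨hY, ((r₁.trans r₂).on_boundary hK hcv hp hrK).mono_len (by linarith)⟩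

theorem reachWithin_slide {K : Set Plane} (hK : IsClosed K) (hcv : Convex ℝ K)
    {p r l a₁ a₂ : Plane} {τ M σ : ℝ} (hτ₀ : 0 ≤ τ) (hτ₁ : τ ≤ 1) (hM : 0 < M) (hp : p ∈ K)
    (hpi : p ∉ interior K) (hσ : 0 < σ)
    (hup : p + σ • EuclideanSpace.single (1 : Fin 2) (1 : ℝ) ∈ interior K)
    (hrK : r ∈ K) (hr : ∀ k ∈ K, k 0 ≤ r 0) (hlK : l ∈ K) (hl : ∀ k ∈ K, l 0 ≤ k 0)
    (h₁K : a₁ ∈ K) (h₁ : ∀ k ∈ K, M * skewHeight τ a₁ + a₁ 0 ≤ M * skewHeight τ k + k 0)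
    (h₂K : a₂ ∈ K) (h₂ : ∀ k ∈ K, M * skewHeight τ a₂ - a₂ 0 ≤ M * skewHeight τ k - k 0) :
    ∃ q, (q = r ∨ q = l) ∧ skewHeight τ p ≤ skewHeight τ q ∧
      ReachWithin (K \ interior K) p q
        ((2 * M + 1) * (skewHeight τ q - skewHeight τ p) + 2 * (a₂ 0 - a₁ 0)) := by
  obtain ⟨f, hf⟩ := geometric_hahn_banach_open_point hcv.interior isOpen_interior hpi
  have hf' : ∀ k ∈ K, f k ≤ f p := by
    intro k hk
    have hk' : k ∈ closure (interior K) := by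
      rw [hcv.closure_interior_eq_closure_of_nonempty_interior ⟨_, hup⟩]
      exact subset_closure hk
    exact closure_minimal (fun z hz => (hf z hz).le) (isClosed_Iic.preimage f.continuous) hk'
  set u := f (EuclideanSpace.single 0 1)
  set v := f (EuclideanSpace.single 1 1)
  have hfc : ∀ z : Plane, f z = z 0 * u + z 1 * v := by
    intro z
    have : z = z 0 • EuclideanSpace.single (0 : Fin 2) (1 : ℝ)
        + z 1 • EuclideanSpace.single (1 : Fin 2) (1 : ℝ) :=
      plane_ext (show (0 : Fin 2) ≠ 1 by simp) (by simp) (by simp)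
    conv_lhs => rw [this]
    rw [map_add, map_smul, map_smul, smul_eq_mul, smul_eq_mul]
  have hv : v < 0 := by
    have := hf _ hup
    rw [map_add, map_smul, smul_eq_mul] at this
    by_contra! h
    nlinarith
  have diff : ∀ k : Plane, f p - f k =
      (-v) * (skewHeight τ k - skewHeight τ p) - (u + τ * v) * (k 0 - p 0) := by
    intro k
    rw [hfc, hfc]
    simp only [skewHeight]
    ring
  rcases le_total 0 (u + τ * v) with h | h
  · have := reachWithin_slide_of_support hK hcv hτ₀ hτ₁ hM h (neg_pos.2 hv) (ς := 1) (by simp) hp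
      (fun k hk => by linarith [diff k, hf' k hk]) (fun k hk => by linarith [diff k, hf k hk])
      hrK (by simpa using hr) h₁K (by simpa using h₁) h₂K (by simpa using h₂)
    refine ⟨r, Or.inl rfl, this.1, ?_⟩
    simpa using this.2
  · have := reachWithin_slide_of_support hK hcv hτ₀ hτ₁ hM (neg_nonneg.2 h) (neg_pos.2 hv)
      (ς := -1) (by simp) hp
      (fun k hk => by linarith [diff k, hf' k hk]) (fun k hk => by linarith [diff k, hf k hk])
      hlK (by simpa using hl) h₂K (by simpa [← sub_eq_add_neg] using h₂) h₁K (by simpa using h₁)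
    refine ⟨l, Or.inr rfl, this.1, ?_⟩
    convert this.2 using 2
    ring

theorem reachWithin_climb {ι : Type*} [Finite ι] {P₀ : Set Plane} {Q : ι → Set Plane}
    (hP : IsClosed P₀) (hK : ∀ i, IsClosed (Q i)) (τ : ℝ) {z : Plane}
    (hz : z ∈ P₀ \ ⋃ i, interior (Q i)) {G : ℝ} (hG : skewHeight τ z ≤ G) :
    ∃ z', z' ∈ P₀ \ ⋃ i, interior (Q i) ∧ skewHeight τ z ≤ skewHeight τ z' ∧
      skewHeight τ z' ≤ G ∧ (skewHeight τ z' = skewHeight τ z → z' = z) ∧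
      ReachWithin (P₀ \ ⋃ i, interior (Q i)) z z' (skewHeight τ z' - skewHeight τ z) ∧
      (z' ∈ frontier P₀ ∨ G ≤ skewHeight τ z' ∨ ∃ i, z' ∈ Q i ∧ ∃ σ : ℝ, 0 < σ ∧
        z' + σ • EuclideanSpace.single (1 : Fin 2) (1 : ℝ) ∈ interior (Q i)) := by
  set e : Plane := EuclideanSpace.single (1 : Fin 2) (1 : ℝ) with he
  have hY : ∀ t : ℝ, skewHeight τ (z + t • e) = skewHeight τ z + t := by
    intro t
    simp only [skewHeight, he, PiLp.add_apply, PiLp.smul_apply, PiLp.single_apply]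
    simp
    ring
  set B : Set ℝ := {t | 0 ≤ t ∧ (z + t • e ∉ interior P₀ ∨ (∃ i, z + t • e ∈ interior (Q i)) ∨
    G - skewHeight τ z ≤ t)} with hB
  have hBne : B.Nonempty := ⟨G - skewHeight τ z, by linarith, Or.inr (Or.inr le_rfl)⟩
  have hBb : BddBelow B := ⟨0, fun t ht => ht.1⟩
  set t₀ := sInf B
  have ht₀ : 0 ≤ t₀ := le_csInf hBne fun t ht => ht.1
  have cont : Continuous fun t : ℝ => z + t • e := by fun_prop
  have before : ∀ t, 0 ≤ t → t < t₀ → z + t • e ∈ interior P₀ ∧ ∀ i, z + t • e ∉ interior (Q i) := by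
    intro t h0 ht
    have : t ∉ B := fun h => ht.not_ge (csInf_le hBb h)
    simp only [hB, mem_ofPred_eq, not_and, not_or, not_not, not_exists] at this
    exact ⟨(this h0).1, (this h0).2.1⟩
  have hmem : ∀ t ∈ Icc 0 t₀, z + t • e ∈ P₀ \ ⋃ i, interior (Q i) := by
    intro t ht
    rcases ht.2.lt_or_eq with h | rfl
    · have := before t ht.1 h
      exact ⟨interior_subset this.1, by simpa using this.2⟩
    rcases ht.1.eq_or_lt with h | h
    · rw [← h]
      simpa using hz
    have hcl : t₀ ∈ closure (Ico 0 t₀) := by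
      rw [closure_Ico h.ne]
      exact ⟨h.le, le_rfl⟩
    have : z + t₀ • e ∈ P₀ ∩ ⋂ i, (interior (Q i))ᶜ := by
      refine closure_minimal (s := Ico 0 t₀) (t := (fun t : ℝ => z + t • e) ⁻¹'
        (P₀ ∩ ⋂ i, (interior (Q i))ᶜ)) (fun t ht => ?_) (IsClosed.preimage cont ?_) hcl
      · have := before t ht.1 ht.2
        exact ⟨interior_subset this.1, by simpa using this.2⟩
      · exact hP.inter (isClosed_iInter fun i => isOpen_interior.isClosed_compl)
    simpa using this
  refine ⟨z + t₀ • e, hmem t₀ ⟨ht₀, le_rfl⟩, by rw [hY]; linarith, ?_, fun h => ?_, ?_, ?_⟩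
  · rw [hY]
    linarith [csInf_le hBb (show G - skewHeight τ z ∈ B from
      ⟨by linarith, Or.inr (Or.inr le_rfl)⟩)]
  · rw [hY, add_eq_left] at h
    simp [h]
  · rw [hY, add_sub_cancel_left]
    refine .of_segment ?_ (by simp [dist_eq_norm, he, norm_smul, abs_of_nonneg ht₀])
    rw [segment_eq_image']
    rintro _ ⟨θ, hθ, rfl⟩
    simp only [add_sub_cancel_left, smul_smul]
    exact hmem _ ⟨mul_nonneg hθ.1 ht₀, mul_le_of_le_one_left ht₀ hθ.2⟩
  · rw [hY]
    by_cases h₁ : z + t₀ • e ∈ interior P₀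
    swap
    · exact Or.inl ⟨subset_closure (hmem t₀ ⟨ht₀, le_rfl⟩).1, h₁⟩
    rcases le_or_gt G (skewHeight τ z + t₀) with h₂ | h₂
    · exact Or.inr (Or.inl h₂)
    have ev : ∀ᶠ t in nhds t₀, z + t • e ∈ interior P₀ ∧ t < G - skewHeight τ z ∧
        ∀ i, z + t₀ • e ∉ Q i → z + t • e ∉ Q i := by
      refine (cont.continuousAt.eventually (isOpen_interior.mem_nhds h₁)).and
        ((eventually_lt_nhds (by linarith)).and (Filter.eventually_all.2 fun i => ?_))
      by_cases h : z + t₀ • e ∈ Q i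
      · exact Filter.Eventually.of_forall fun t h' => absurd h h'
      · exact (cont.continuousAt.eventually ((hK i).isOpen_compl.mem_nhds h)).mono fun t ht _ => ht
    obtain ⟨ε, hε, hball⟩ := Metric.eventually_nhds_iff.1 ev
    obtain ⟨t, htB, ht⟩ := exists_lt_of_csInf_lt hBne (show t₀ < t₀ + ε by linarith)
    have htt : t₀ ≤ t := csInf_le hBb htB
    obtain ⟨g₁, g₂, g₃⟩ := hball (y := t) (by rw [Real.dist_eq, abs_lt]; constructor <;> linarith)
    rcases htB.2 with h | ⟨i, hi⟩ | h
    · exact absurd g₁ h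
    · have hQ : z + t₀ • e ∈ Q i := by
        by_contra h
        exact g₃ i h (interior_subset hi)
      have hne : t₀ ≠ t := by
        rintro rfl
        exact (hmem _ ⟨ht₀, le_rfl⟩).2 (mem_iUnion.2 ⟨i, hi⟩)
      refine Or.inr (Or.inr ⟨i, hQ, t - t₀, sub_pos.2 (htt.lt_of_ne hne), ?_⟩)
      rwa [add_assoc, ← add_smul, add_sub_cancel]
    · linarith

theorem exists_coord_lt_of_mem_interior {K : Set Plane} {z : Plane} (hz : z ∈ interior K)
    (i : Fin 2) : (∃ k ∈ K, z i < k i) ∧ ∃ k ∈ K, k i < z i := by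
  obtain ⟨ε, hε, h⟩ := exists_pos_add_smul_mem_interior hz (EuclideanSpace.single i 1)
  obtain ⟨ε', hε', h'⟩ := exists_pos_add_smul_mem_interior hz (EuclideanSpace.single i (-1))
  exact ⟨⟨_, interior_subset h, by simpa using hε⟩, ⟨_, interior_subset h', by simpa using hε'⟩⟩

theorem skewHeight_sub_le {τ : ℝ} (hτ₀ : 0 ≤ τ) (hτ₁ : τ ≤ 1) (a b : Plane) :
    skewHeight τ a - skewHeight τ b ≤ |a 0 - b 0| + |a 1 - b 1| := by
  have h₁ := le_abs_self (a 1 - b 1)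
  have h₂ := neg_abs_le (a 0 - b 0)
  have h₃ := abs_nonneg (a 0 - b 0)
  simp only [skewHeight]
  nlinarith

theorem hole_boundary_subset {ι : Type*} {P₀ : Set Plane} {Q : ι → Set Plane}
    (hdisj : Pairwise (Function.onFun Disjoint Q)) (hsub : ∀ i, Q i ⊆ interior P₀) (i : ι) :
    Q i \ interior (Q i) ⊆ P₀ \ ⋃ j, interior (Q j) := by
  rintro z ⟨hz, hzi⟩
  refine ⟨interior_subset (hsub i hz), fun h => ?_⟩
  obtain ⟨j, hj⟩ := mem_iUnion.1 h
  rcases eq_or_ne i j with rfl | hij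
  · exact hzi hj
  · exact (hdisj hij).le_bot ⟨hz, interior_subset hj⟩

open Classical in
theorem reachWithin_ascend {ι : Type*} [Fintype ι] {P₀ : Set Plane} {Q : ι → Set Plane}
    (hP : IsClosed P₀) (hK : ∀ i, IsClosed (Q i)) (hcv : ∀ i, Convex ℝ (Q i))
    (hdisj : Pairwise (Function.onFun Disjoint Q)) (hsub : ∀ i, Q i ⊆ interior P₀)
    {τ M δ G : ℝ} (hτ₀ : 0 ≤ τ) (hτ₁ : τ ≤ 1) (hM : 0 < M) (hδ : 0 ≤ δ)
    (hd : ∀ i, ∀ x ∈ Q i, ∀ y ∈ Q i, dist x y ≤ δ)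
    {ext : ι → Bool → Plane} (hext : ∀ i b, ext i b ∈ Q i)
    (hmax : ∀ i, ∀ k ∈ Q i, k 0 ≤ ext i true 0) (hmin : ∀ i, ∀ k ∈ Q i, ext i false 0 ≤ k 0)
    {a₁ a₂ : ι → Plane} (h₁K : ∀ i, a₁ i ∈ Q i)
    (h₁ : ∀ i, ∀ k ∈ Q i, M * skewHeight τ (a₁ i) + a₁ i 0 ≤ M * skewHeight τ k + k 0)
    (h₂K : ∀ i, a₂ i ∈ Q i)
    (h₂ : ∀ i, ∀ k ∈ Q i, M * skewHeight τ (a₂ i) - a₂ i 0 ≤ M * skewHeight τ k - k 0)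
    (n : ℕ) : ∀ (p : Plane) (i : ι) (σ : ℝ), p ∈ P₀ \ ⋃ j, interior (Q j) → p ∈ Q i → 0 < σ →
      p + σ • EuclideanSpace.single (1 : Fin 2) (1 : ℝ) ∈ interior (Q i) → skewHeight τ p ≤ G →
      (Finset.univ.filter fun x : ι × Bool =>
        skewHeight τ p ≤ skewHeight τ (ext x.1 x.2)).card = n →
      ∃ w, (w ∈ frontier P₀ ∨ G ≤ skewHeight τ w) ∧
        ReachWithin (P₀ \ ⋃ j, interior (Q j)) p w ((2 * M + 1) * (G + 2 * δ - skewHeight τ p) +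
          ∑ x : ι × Bool with skewHeight τ p ≤ skewHeight τ (ext x.1 x.2),
            2 * (a₂ x.1 0 - a₁ x.1 0)) := by
  have hgap : ∀ i, 0 ≤ 2 * (a₂ i 0 - a₁ i 0) := fun i => by
    linarith [h₁ i _ (h₂K i), h₂ i _ (h₁K i)]
  induction n using Nat.strong_induction_on with
  | _ n ih =>
  intro p i σ hpP hp hσ hup hpG hcard
  have hpi : p ∉ interior (Q i) := fun h => hpP.2 (mem_iUnion.2 ⟨i, h⟩)
  obtain ⟨q, hq, hpq, hreach⟩ := reachWithin_slide (hK i) (hcv i) hτ₀ hτ₁ hM hp hpi hσ hup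
    (hext i true) (hmax i) (hext i false) (hmin i) (h₁K i) (h₁ i) (h₂K i) (h₂ i)
  obtain ⟨b, rfl⟩ : ∃ b, q = ext i b := by
    rcases hq with rfl | rfl
    exacts [⟨true, rfl⟩, ⟨false, rfl⟩]
  clear hq
  have hqK := hext i b
  have hreach := hreach.mono_set (hole_boundary_subset hdisj hsub i)
  have hqp : skewHeight τ (ext i b) - skewHeight τ p ≤ 2 * δ := by
    have := skewHeight_sub_le hτ₀ hτ₁ (ext i b) p
    have := abs_coord_sub_le_dist (ext i b) p 0
    have := abs_coord_sub_le_dist (ext i b) p 1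
    have := hd i _ hqK p hp
    linarith
  have hmem : (i, b) ∈ Finset.univ.filter fun x : ι × Bool =>
      skewHeight τ p ≤ skewHeight τ (ext x.1 x.2) := by simpa using hpq
  have hsingle := Finset.single_le_sum (f := fun x : ι × Bool => 2 * (a₂ x.1 0 - a₁ x.1 0))
    (fun x _ => hgap x.1) hmem
  dsimp only at hsingle
  rcases le_total G (skewHeight τ (ext i b)) with hqG | hqG
  · refine ⟨ext i b, Or.inr hqG, hreach.mono_len (add_le_add ?_ hsingle)⟩
    exact mul_le_mul_of_nonneg_left (by linarith) (by linarith)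
  obtain ⟨z, hzP, hqz, hzG', hzq, hclimb, hz⟩ := reachWithin_climb hP hK τ hreach.right_mem hqG
  by_cases hend : z ∈ frontier P₀ ∨ G ≤ skewHeight τ z
  · refine ⟨z, hend, (hreach.trans hclimb).mono_len ?_⟩
    nlinarith
  obtain ⟨hzf, hzG⟩ := not_or.1 hend
  obtain ⟨j, hzj, σ', hσ', hup'⟩ := (hz.resolve_left hzf).resolve_left hzG
  have hlt : skewHeight τ (ext i b) < skewHeight τ z := by
    refine hqz.lt_of_ne fun h => ?_
    obtain rfl := hzq h.symm
    obtain rfl : i = j := by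
      by_contra hij
      exact (hdisj hij).le_bot ⟨hqK, hzj⟩
    obtain ⟨⟨k, hk, hk'⟩, k', hk'', hk'''⟩ := exists_coord_lt_of_mem_interior hup' 0
    simp only [PiLp.add_apply, PiLp.smul_apply, PiLp.single_apply, zero_ne_one, if_false,
      smul_zero, add_zero] at hk' hk'''
    cases b
    · exact hk'''.not_ge (hmin i k' hk'')
    · exact hk'.not_ge (hmax i k hk)
  have hsubset : (Finset.univ.filter fun x : ι × Bool =>
      skewHeight τ z ≤ skewHeight τ (ext x.1 x.2)) ⊆ (Finset.univ.filter fun x : ι × Bool =>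
      skewHeight τ p ≤ skewHeight τ (ext x.1 x.2)).erase (i, b) := by
    intro x hx
    simp only [Finset.mem_filter, Finset.mem_univ, true_and, Finset.mem_erase] at hx ⊢
    refine ⟨?_, by linarith⟩
    rintro rfl
    exact hlt.not_ge hx
  have hlt' := (Finset.card_le_card hsubset).trans_lt (Finset.card_erase_lt_of_mem hmem)
  obtain ⟨w, hw, hreach'⟩ := ih _ (hcard ▸ hlt') z j σ' hzP hzj hσ' hup' (by linarith) rfl
  refine ⟨w, hw, ((hreach.trans hclimb).trans hreach').mono_len ?_⟩
  have hsum := Finset.sum_le_sum_of_subset_of_nonneg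
    (f := fun x : ι × Bool => 2 * (a₂ x.1 0 - a₁ x.1 0)) hsubset (fun x _ _ => hgap x.1)
  rw [← Finset.add_sum_erase _ _ hmem]
  dsimp only at hsum ⊢
  nlinarith

theorem exists_reachWithin_high {ι : Type*} [Fintype ι] {P₀ : Set Plane} {Q : ι → Set Plane}
    (hP : IsClosed P₀) (hK : ∀ i, IsCompact (Q i)) (hne : ∀ i, (Q i).Nonempty)
    (hcv : ∀ i, Convex ℝ (Q i)) (hdisj : Pairwise (Function.onFun Disjoint Q))
    (hsub : ∀ i, Q i ⊆ interior P₀) {δ L : ℝ} (hδ : 0 ≤ δ) (hL : 0 ≤ L)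
    (hd : ∀ i, ∀ x ∈ Q i, ∀ y ∈ Q i, dist x y ≤ δ) {N : ℕ} (hN : 0 < N)
    {s : Plane} (hs : s ∈ P₀ \ ⋃ j, interior (Q j)) :
    ∃ w, (w ∈ frontier P₀ ∨ L ≤ |w 0 - s 0| + |w 1 - s 1|) ∧
      ReachWithin (P₀ \ ⋃ j, interior (Q j)) s w
        ((2 * N + 1) * (L + 2 * δ) + 8 * (Fintype.card ι * δ / N)) := by
  have hN' : (0 : ℝ) < N := Nat.cast_pos.2 hN
  have hA : ∀ i, ∀ m : ℕ, ∃ a ∈ Q i, ∀ k ∈ Q i,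
      a 1 - (m / N : ℝ) * a 0 ≤ k 1 - (m / N : ℝ) * k 0 := fun i m => by
    obtain ⟨a, ha, hmin⟩ := (hK i).exists_isMinOn (hne i)
      (f := fun k : Plane => k 1 - (m / N : ℝ) * k 0) (by fun_prop)
    exact ⟨a, ha, fun k hk => hmin hk⟩
  choose A hAK hA using hA
  have hE : ∀ i, ∀ b : Bool, ∃ a ∈ Q i, ∀ k ∈ Q i, cond b (k 0 ≤ a 0) (a 0 ≤ k 0) := by
    intro i b
    cases b
    · obtain ⟨a, ha, h⟩ := (hK i).exists_isMinOn (hne i) (f := fun k : Plane => k 0) (by fun_prop)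
      exact ⟨a, ha, fun k hk => h hk⟩
    · obtain ⟨a, ha, h⟩ := (hK i).exists_isMaxOn (hne i) (f := fun k : Plane => k 0) (by fun_prop)
      exact ⟨a, ha, fun k hk => h hk⟩
  choose ext hext hopt using hE
  have hcoord : ∀ i, ∀ x ∈ Q i, ∀ y ∈ Q i, x 0 - y 0 ≤ δ := fun i x hx y hy =>
    (le_abs_self _).trans ((abs_coord_sub_le_dist x y 0).trans (hd i x hx y hy))
  have htel : ∀ i, ∑ k ∈ Finset.range N, (A i (k + 2) 0 - A i k 0) ≤ 2 * δ := by
    intro i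
    have e₁ := Finset.sum_range_sub (fun k => A i k 0) N
    have e₂ := Finset.sum_range_sub (fun k => A i (k + 1) 0) N
    have e₃ := hcoord i _ (hAK i N) _ (hAK i 0)
    have e₄ := hcoord i _ (hAK i (N + 1)) _ (hAK i (0 + 1))
    have : ∀ k, A i (k + 2) 0 - A i k 0 =
        (A i (k + 1) 0 - A i k 0) + (A i (k + 1 + 1) 0 - A i (k + 1) 0) := fun k => by ring
    simp only [this, Finset.sum_add_distrib, e₁, e₂]
    linarith
  obtain ⟨k, hk, hksum⟩ : ∃ k ∈ Finset.range N, ∑ i, (A i (k + 2) 0 - A i k 0) ≤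
      2 * (Fintype.card ι * δ / N) := by
    refine Finset.exists_le_of_sum_le ⟨0, Finset.mem_range.2 hN⟩ ?_
    rw [Finset.sum_comm, Finset.sum_const, Finset.card_range, nsmul_eq_mul]
    refine (Finset.sum_le_sum fun i _ => htel i).trans (le_of_eq ?_)
    rw [Finset.sum_const, nsmul_eq_mul, Finset.card_univ]
    field_simp
  have hkN : ((k : ℝ) + 1) ≤ N := by exact_mod_cast Finset.mem_range.1 hk
  set τ : ℝ := (k + 1) / N with hτ
  have hτ₀ : 0 ≤ τ := by positivity
  have hτ₁ : τ ≤ 1 := (div_le_one hN').2 hkN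
  have lower : ∀ z : Plane, (N : ℝ) * skewHeight τ z + z 0 = N * (z 1 - (k / N : ℝ) * z 0) := by
    intro z
    simp only [skewHeight, hτ]
    field_simp
    ring
  have upper : ∀ z : Plane, (N : ℝ) * skewHeight τ z - z 0 =
      N * (z 1 - ((k + 2 : ℕ) / N : ℝ) * z 0) := by
    intro z
    simp only [skewHeight, hτ]
    push_cast
    field_simp
    ring
  have h₁ : ∀ i, ∀ z ∈ Q i, (N : ℝ) * skewHeight τ (A i k) + A i k 0 ≤
      N * skewHeight τ z + z 0 := fun i z hz => by
    rw [lower, lower]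
    exact mul_le_mul_of_nonneg_left (hA i k z hz) hN'.le
  have h₂ : ∀ i, ∀ z ∈ Q i, (N : ℝ) * skewHeight τ (A i (k + 2)) - A i (k + 2) 0 ≤
      N * skewHeight τ z - z 0 := fun i z hz => by
    rw [upper, upper]
    exact mul_le_mul_of_nonneg_left (hA i (k + 2) z hz) hN'.le
  have high : ∀ w, skewHeight τ s + L ≤ skewHeight τ w → L ≤ |w 0 - s 0| + |w 1 - s 1| :=
    fun w hw => by linarith [skewHeight_sub_le hτ₀ hτ₁ w s]
  have hcost : 0 ≤ 8 * (Fintype.card ι * δ / N) := by positivity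
  obtain ⟨z, hzP, hsz, hzG, -, hclimb, hz⟩ := reachWithin_climb hP (fun i => (hK i).isClosed) τ hs
    (show skewHeight τ s ≤ skewHeight τ s + L by linarith)
  by_cases hend : z ∈ frontier P₀ ∨ skewHeight τ s + L ≤ skewHeight τ z
  · refine ⟨z, hend.imp_right (high z), hclimb.mono_len ?_⟩
    nlinarith
  obtain ⟨hzf, hzL⟩ := not_or.1 hend
  obtain ⟨j, hzj, σ, hσ, hup⟩ := (hz.resolve_left hzf).resolve_left hzL
  obtain ⟨w, hw, hreach⟩ := reachWithin_ascend hP (fun i => (hK i).isClosed) hcv hdisj hsub hτ₀ hτ₁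
    hN' hδ hd hext (fun i => hopt i true) (fun i => hopt i false) (fun i => hAK i k) h₁
    (fun i => hAK i (k + 2)) h₂ _ z j σ hzP hzj hσ hup hzG rfl
  refine ⟨w, hw.imp_right (high w), (hclimb.trans hreach).mono_len ?_⟩
  have hsum : ∑ x : ι × Bool with skewHeight τ z ≤ skewHeight τ (ext x.1 x.2),
      2 * (A x.1 (k + 2) 0 - A x.1 k 0) ≤ 8 * (Fintype.card ι * δ / N) := by
    refine (Finset.sum_le_sum_of_subset_of_nonneg (Finset.subset_univ _) fun x _ _ => ?_).trans ?_
    · linarith [h₁ x.1 _ (hAK x.1 (k + 2)), h₂ x.1 _ (hAK x.1 k)]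
    · rw [Fintype.sum_prod_type]
      simp only [Fintype.sum_bool, ← two_mul, ← Finset.mul_sum]
      linarith
  nlinarith

theorem exists_frontier_above {P₀ : Set Plane} (hP : IsCompact P₀) {y : Plane} (hy : y ∈ P₀)
    {i j : Fin 2} (hij : i ≠ j) : ∃ f ∈ frontier P₀, f i = y i := by
  obtain ⟨f, ⟨hfP, hfi⟩, hmax⟩ := (hP.inter_right (t := {z : Plane | z i = y i})
    (isClosed_eq (by fun_prop) (by fun_prop))).exists_isMaxOn ⟨y, hy, rfl⟩
    (f := fun z : Plane => z j) (by fun_prop)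
  refine ⟨f, ⟨subset_closure hfP, fun hf => ?_⟩, hfi⟩
  obtain ⟨ε, hε, h⟩ := exists_pos_add_smul_mem_interior hf (EuclideanSpace.single j 1)
  have hle : (f + ε • EuclideanSpace.single j (1 : ℝ) : Plane) j ≤ f j :=
    hmax ⟨interior_subset h, by simpa [hij] using hfi⟩
  simp only [PiLp.add_apply, PiLp.smul_apply, PiLp.single_apply, if_true, smul_eq_mul,
    mul_one] at hle
  linarith

open Classical in
theorem exists_coord_few_holes {ι : Type*} [Fintype ι] {Q : ι → Set Plane} {δ ρ : ℝ}
    (hδ : 0 < δ) (hd : ∀ m, ∀ x ∈ Q m, ∀ y ∈ Q m, dist x y ≤ δ) (hρ : 0 < ρ) (i : Fin 2)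
    {s w : ℝ} (hsw : ρ * δ ≤ |w - s|) :
    ∃ x ∈ uIcc s w, ((Finset.univ.filter fun m => ∃ z ∈ Q m, z i = x).card : ℝ) ≤
      2 * (Fintype.card ι / ρ) := by
  set n : ℕ := ⌊ρ / 2⌋₊ + 1 with hn
  have hn₁ : ρ / 2 ≤ n := by
    rw [hn]
    push_cast
    exact (Nat.lt_floor_add_one _).le
  have hn₂ : ∀ k ∈ Finset.range n, (k : ℝ) ≤ ρ / 2 := fun k hk => by
    rw [Finset.mem_range, hn, Nat.lt_succ_iff] at hk
    exact (Nat.cast_le.2 hk).trans (Nat.floor_le (by positivity))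
  obtain ⟨ς, hς, hςw⟩ : ∃ ς : ℝ, |ς| = 1 ∧ w - s = ς * |w - s| := by
    rcases le_total 0 (w - s) with h | h
    · exact ⟨1, by simp, by simp [abs_of_nonneg h]⟩
    · exact ⟨-1, by simp, by simp [abs_of_nonpos h]⟩
  set x : ℕ → ℝ := fun k => s + ς * (2 * δ * k) with hx
  have hsep : ∀ m, ∀ k k' : ℕ, (∃ z ∈ Q m, z i = x k) → (∃ z ∈ Q m, z i = x k') → k = k' := by
    rintro m k k' ⟨z, hz, hzk⟩ ⟨z', hz', hzk'⟩
    by_contra hne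
    have h₁ := (abs_coord_sub_le_dist z z' i).trans (hd m z hz z' hz')
    have h₂ : z i - z' i = ς * (2 * δ * ((k : ℝ) - k')) := by
      rw [hzk, hzk', hx]
      ring
    rw [h₂, abs_mul, hς, one_mul, abs_mul, abs_of_pos (by linarith : 0 < 2 * δ)] at h₁
    have h₃ : (1 : ℝ) ≤ |(k : ℝ) - k'| := by
      have : (1 : ℤ) ≤ |(k : ℤ) - k'| := Int.one_le_abs (by omega)
      exact_mod_cast this
    nlinarith
  have hcount : ∑ k ∈ Finset.range n, (Finset.univ.filter fun m => ∃ z ∈ Q m, z i = x k).card ≤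
      Fintype.card ι := by
    rw [← Finset.card_biUnion]
    · exact Finset.card_le_univ _
    · intro k _ k' _ hkk'
      refine Finset.disjoint_left.2 fun m hm hm' => hkk' ?_
      exact hsep m k k' (Finset.mem_filter.1 hm).2 (Finset.mem_filter.1 hm').2
  have hn₀ : (0 : ℝ) < n := by linarith
  obtain ⟨k, hk, hkc⟩ : ∃ k ∈ Finset.range n,
      ((Finset.univ.filter fun m => ∃ z ∈ Q m, z i = x k).card : ℝ) ≤ Fintype.card ι / n := by
    refine Finset.exists_le_of_sum_le ⟨0, Finset.mem_range.2 (by omega)⟩ ?_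
    rw [Finset.sum_const, Finset.card_range, nsmul_eq_mul, mul_div_cancel₀ _ hn₀.ne']
    exact_mod_cast hcount
  refine ⟨x k, ?_, hkc.trans ?_⟩
  · have hk' := hn₂ k hk
    have h₁ : 2 * δ * k ≤ |w - s| := by nlinarith
    have h₂ : 0 ≤ 2 * δ * (k : ℝ) := by positivity
    rw [mem_uIcc]
    have h₃ : ς = 1 ∨ ς = -1 := by
      rcases abs_cases ς with h | h
      · exact Or.inl (by linarith)
      · exact Or.inr (by linarith)
    rcases h₃ with rfl | rfl
    · exact Or.inl ⟨by simp only [hx]; linarith, by simp only [hx]; linarith⟩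
    · exact Or.inr ⟨by simp only [hx]; linarith, by simp only [hx]; linarith⟩
  · rw [div_le_iff₀ hn₀]
    have : 2 * ((Fintype.card ι : ℝ) / ρ) * (ρ / 2) = Fintype.card ι := by field_simp
    calc (Fintype.card ι : ℝ) = 2 * ((Fintype.card ι : ℝ) / ρ) * (ρ / 2) := this.symm
      _ ≤ _ := mul_le_mul_of_nonneg_left hn₁ (by positivity)

theorem IsConvexPolygon.isCompact {K : Set Plane} (h : IsConvexPolygon K) : IsCompact K := by
  obtain ⟨S, -, rfl⟩ := h
  exact S.finite_toSet.isCompact_convexHull ℝ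

theorem IsConvexPolygon.convex {K : Set Plane} (h : IsConvexPolygon K) : Convex ℝ K := by
  obtain ⟨S, -, rfl⟩ := h
  exact convex_convexHull ℝ _

theorem IsConvexPolygon.nonempty {K : Set Plane} (h : IsConvexPolygon K) : K.Nonempty := by
  obtain ⟨S, hS, rfl⟩ := h
  exact convexHull_nonempty_iff.2 (Finset.coe_nonempty.2 hS)

theorem exists_reachWithin_frontier {ι : Type*} [Fintype ι] {P₀ : Set Plane} {Q : ι → Set Plane}
    (hP : IsCompact P₀) (hPcv : Convex ℝ P₀) (hK : ∀ i, IsCompact (Q i))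
    (hne : ∀ i, (Q i).Nonempty) (hcv : ∀ i, Convex ℝ (Q i))
    (hdisj : Pairwise (Function.onFun Disjoint Q)) (hsub : ∀ i, Q i ⊆ interior P₀) {δ ρ : ℝ}
    (hδ : 0 < δ) (hd : ∀ i, ∀ x ∈ Q i, ∀ y ∈ Q i, dist x y ≤ δ) (hρ : 0 < ρ) {N : ℕ} (hN : 0 < N)
    {s : Plane} (hs : s ∈ P₀ \ ⋃ j, interior (Q j)) :
    ∃ f ∈ frontier P₀, ReachWithin (P₀ \ ⋃ j, interior (Q j)) s f
      (((2 * N + 1) * (2 * ρ * δ + 2 * δ) + 8 * (Fintype.card ι * δ / N)) +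
        (Metric.diam (P₀ \ ⋃ j, interior (Q j)) + 13 * δ * (2 * (Fintype.card ι / ρ)))) := by
  classical
  obtain ⟨w, hw, hreach⟩ := exists_reachWithin_high hP.isClosed hK hne hcv hdisj hsub hδ.le
    (show 0 ≤ 2 * ρ * δ by positivity) hd hN hs
  rcases hw with hw | hw
  · refine ⟨w, hw, hreach.mono_len (le_add_of_nonneg_right ?_)⟩
    have := Metric.diam_nonneg (s := P₀ \ ⋃ j, interior (Q j))
    positivity
  obtain ⟨i, j, hij, hi⟩ : ∃ i j : Fin 2, i ≠ j ∧ ρ * δ ≤ |w i - s i| := by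
    rcases le_total (ρ * δ) |w 0 - s 0| with h | h
    · exact ⟨0, 1, by simp, h⟩
    · exact ⟨1, 0, by simp, by linarith⟩
  obtain ⟨x, hx, hcard⟩ := exists_coord_few_holes hδ hd hρ i hi
  obtain ⟨y, rfl, hy⟩ := hreach.exists_coord_eq i hx
  obtain ⟨f, hf, hfi⟩ := exists_frontier_above hP hy.right_mem.1 hij
  have hfP : f ∈ P₀ := hP.isClosed.frontier_subset hf
  have hfQ : ∀ m, f ∉ interior (Q m) := fun m h => hf.2 (hsub m (interior_subset h))
  have hyQ : ∀ m, y ∉ interior (Q m) := by simpa using hy.right_mem.2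
  have hline := reachWithin_line hij (fun m => (hK m).isClosed) hcv hδ hd hdisj hyQ hfQ hfi.symm
    Finset.univ
  have hdist : dist y f ≤ Metric.diam (P₀ \ ⋃ j, interior (Q j)) :=
    Metric.dist_le_diam_of_mem (hP.isBounded.subset sdiff_subset) hy.right_mem
      ⟨hfP, by simpa using hfQ⟩
  refine ⟨f, hf, hy.trans ((hline.mono_set ?_).mono_len (add_le_add hdist
    (mul_le_mul_of_nonneg_left hcard (by positivity))))⟩
  simp only [Finset.mem_univ, iUnion_true]
  refine sdiff_subset_sdiff_left (union_subset (hPcv.segment_subset hy.right_mem.1 hfP) ?_)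
  exact iUnion_subset fun m => (hsub m).trans interior_subset

theorem escape_cost_bound {q N D Δ : ℝ} (hq : 1 ≤ q) (hN₁ : q ≤ N) (hN₂ : N ≤ 2 * q) (hD : 0 ≤ D)
    (hΔ : 0 ≤ Δ) :
    ((2 * N + 1) * (2 * q ^ 2 * (Δ * D) + 2 * (Δ * D)) + 8 * (q ^ 4 * (Δ * D) / N)) +
      (D + 13 * (Δ * D) * (2 * (q ^ 4 / q ^ 2))) ≤ 54 * (1 + q ^ 3 * Δ) * D := by
  have hq₀ : 0 < q := by linarith
  set δ := Δ * D with hδ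
  have hδ₀ : 0 ≤ δ := mul_nonneg hΔ hD
  have e₁ : (2 * N + 1) * (2 * q ^ 2 * δ + 2 * δ) ≤ 5 * q * (4 * q ^ 2 * δ) := by
    refine mul_le_mul (by linarith) ?_ (by positivity) (by positivity)
    nlinarith [mul_le_mul_of_nonneg_right (one_le_pow₀ hq (n := 2)) hδ₀]
  have e₂ : q ^ 4 * δ / N ≤ q ^ 3 * δ := by
    rw [div_le_iff₀ (by linarith)]
    nlinarith [mul_le_mul_of_nonneg_left hN₁ (show 0 ≤ q ^ 3 * δ by positivity)]
  have e₃ : q ^ 4 / q ^ 2 = q ^ 2 := by field_simp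
  have e₄ : q ^ 2 * δ ≤ q ^ 3 * δ := by
    refine mul_le_mul_of_nonneg_right (pow_le_pow_right₀ hq (by norm_num)) hδ₀
  have e₅ : 54 * (1 + q ^ 3 * Δ) * D = 54 * D + 54 * (q ^ 3 * δ) := by
    rw [hδ]
    ring
  rw [e₃, e₅]
  nlinarith

/-- There is an absolute constant `C > 0` such that for every `h ≥ 1`, `Δ > 0`,
every polygonal domain `P ∈ 𝒞(h)` with holes of diameter at most `Δ·diam₂(P)`, and every
`s ∈ P`, there is a continuous path in `P` from `s` to `frontier P₀` of length at most
`C·(1 + h^{3/4}·Δ)·diam₂(P)`. -/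
theorem escape_path_three_quarters :
    ∃ C : ℝ, 0 < C ∧
      ∀ (h : ℕ), 1 ≤ h → ∀ (Δ : ℝ), 0 < Δ →
        ∀ (P₀ : Set Plane) (Q : Fin h → Set Plane),
          IsConvexPolygon P₀ →
          (∀ i, IsConvexPolygon (Q i)) →
          Pairwise (Function.onFun Disjoint Q) →
          (∀ i, Q i ⊆ interior P₀) →
          (∀ i, Metric.diam (Q i) ≤ Δ * Metric.diam (P₀ \ ⋃ j, interior (Q j))) →
          ∀ s ∈ (P₀ \ ⋃ i, interior (Q i)),
            ∃ γ : ℝ → Plane,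
              ContinuousOn γ (Set.Icc 0 1) ∧ γ 0 = s ∧ γ 1 ∈ frontier P₀ ∧
              Set.MapsTo γ (Set.Icc 0 1) (P₀ \ ⋃ i, interior (Q i)) ∧
              pathLen γ ≤
                ENNReal.ofReal
                  (C * (1 + (h : ℝ) ^ ((3 : ℝ) / 4) * Δ) *
                    Metric.diam (P₀ \ ⋃ i, interior (Q i))) := by
  refine ⟨54, by norm_num, fun h hh Δ hΔ P₀ Q hP hQ hdisj hsub hdiam s hs => ?_⟩
  set P := P₀ \ ⋃ i, interior (Q i) with hPdef
  suffices ∃ f ∈ frontier P₀, ReachWithin P s f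
      (54 * (1 + (h : ℝ) ^ ((3 : ℝ) / 4) * Δ) * Metric.diam P) by
    obtain ⟨f, hf, hreach⟩ := this
    obtain ⟨γ, ⟨hγ, h₀, h₁, hmaps⟩, hlen⟩ := hreach.exists_path
    exact ⟨γ, hγ, h₀, h₁ ▸ hf, hmaps, hlen⟩
  have hPb : Bornology.IsBounded P := hP.isCompact.isBounded.subset sdiff_subset
  by_cases hsf : s ∈ frontier P₀
  · have := Metric.diam_nonneg (s := P)
    exact ⟨s, hsf, .of_segment (by simpa using hs) (by rw [dist_self]; positivity)⟩
  have hD : 0 < Metric.diam P := by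
    obtain ⟨f, hf, -⟩ := exists_frontier_above hP.isCompact hs.1 (show (0 : Fin 2) ≠ 1 by simp)
    have hfP : f ∈ P := ⟨hP.isCompact.isClosed.frontier_subset hf, by
      simpa using fun m h => hf.2 (hsub m (interior_subset h))⟩
    have hne : s ≠ f := fun h => hsf (h ▸ hf)
    exact (dist_pos.2 hne).trans_le (Metric.dist_le_diam_of_mem hPb hs hfP)
  have hh' : (1 : ℝ) ≤ h := by exact_mod_cast hh
  set q : ℝ := (h : ℝ) ^ ((1 : ℝ) / 4) with hq
  have hq₁ : 1 ≤ q := Real.one_le_rpow hh' (by norm_num)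
  have hq₄ : q ^ 4 = h := by
    rw [hq, ← Real.rpow_natCast, ← Real.rpow_mul (by linarith)]
    norm_num
  have hq₃ : (h : ℝ) ^ ((3 : ℝ) / 4) = q ^ 3 := by
    rw [hq, ← Real.rpow_natCast, ← Real.rpow_mul (by linarith)]
    norm_num
  have hN₂ : (⌈q⌉₊ : ℝ) ≤ 2 * q := by linarith [Nat.ceil_lt_add_one (show 0 ≤ q by linarith)]
  obtain ⟨f, hf, hreach⟩ := exists_reachWithin_frontier (ρ := q ^ 2) (N := ⌈q⌉₊) hP.isCompact
    hP.convex (fun i => (hQ i).isCompact) (fun i => (hQ i).nonempty) (fun i => (hQ i).convex) hdisj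
    hsub (mul_pos hΔ hD) (fun i x hx y hy => (Metric.dist_le_diam_of_mem
      (hQ i).isCompact.isBounded hx hy).trans (hdiam i)) (by positivity)
    (Nat.ceil_pos.2 (by linarith)) hs
  rw [Fintype.card_fin, ← hq₄, ← hPdef] at hreach
  rw [hq₃]
  exact ⟨f, hf, hreach.mono_len (escape_cost_bound hq₁ (Nat.le_ceil q) hN₂ hD.le hΔ.le)⟩
end
end

section
/- There is an absolute constant C > 0 with the following property. Let h ≥ 1, let P₀ ⊆ ℝ² be a convex polygon, and let S₁, …, S_h be pairwise disjoint closed line segments Sᵢ = [aᵢ, bᵢ] contained in the interior of P₀, each of length at most Δ·diam₂(P₀), where Δ ≥ 1/h. Then for every point s ∈ P₀ \ ⋃_{i=1}^h Sᵢ and every ε > 0 there exist a unit vector v ∈ ℝ² and a continuous path γ : [0,1] → ℝ² with γ(0) = s, γ(1) ∈ frontier(P₀), image of γ contained in P₀ \ ⋃_{i=1}^h Sᵢ up to the final point, such that t ↦ ⟪γ(t), v⟫ is monotone nondecreasing (i.e., γ is v-monotone), and the length of γ is at most C·h^{1/2}·Δ^{1/2}·diam₂(P₀) + ε. -/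
open Set Metric ENNReal RealInnerProductSpace

noncomputable section

open MeasureTheory

/-- There is a continuous path from `p` to `q`, monotone in direction `v` and of length at most `L`,
which stays in `A` up to its final point. -/
def HasMonotonePath (A : Set Plane) (v p q : Plane) (L : ℝ) : Prop :=
  ∃ γ : ℝ → Plane, ContinuousOn γ (Icc 0 1) ∧ γ 0 = p ∧ γ 1 = q ∧ MapsTo γ (Ico 0 1) A ∧
    MonotoneOn (fun t => ⟪γ t, v⟫) (Icc 0 1) ∧ pathLen γ ≤ ENNReal.ofReal L

namespace HasMonotonePath

variable {A : Set Plane} {v p q r : Plane} {L L' : ℝ}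

lemma mono_length (h : HasMonotonePath A v p q L) (hL : L ≤ L') : HasMonotonePath A v p q L' := by
  obtain ⟨γ, h₁, h₂, h₃, h₄, h₅, h₆⟩ := h
  exact ⟨γ, h₁, h₂, h₃, h₄, h₅, h₆.trans (ENNReal.ofReal_le_ofReal hL)⟩

lemma of_segment (hA : ∀ t ∈ Ico (0 : ℝ) 1, p + t • (q - p) ∈ A) (hv : 0 ≤ ⟪q - p, v⟫) :
    HasMonotonePath A v p q ‖q - p‖ := by
  refine ⟨fun t => p + t • (q - p), by fun_prop, by simp, by simp, hA, ?_, ?_⟩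
  · intro t _ t' _ htt
    simp only [inner_add_left, real_inner_smul_left]
    gcongr
  · have hlip : LipschitzOnWith ‖q - p‖₊ (fun t : ℝ => p + t • (q - p)) univ := by
      refine LipschitzOnWith.of_dist_le_mul fun x _ y _ => ?_
      rw [dist_add_left, dist_eq_norm, ← sub_smul, norm_smul, mul_comm, dist_eq_norm]
      rfl
    have h := hlip.comp_eVariationOn_le (g := id) (s := Icc 0 1) (mapsTo_univ _ _)
    rw [eVariationOn_id_Icc, sub_zero, ENNReal.ofReal_one, mul_one] at h
    rwa [← coe_nnnorm, ENNReal.ofReal_coe_nnreal]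

lemma trans (h₁ : HasMonotonePath A v p q L) (h₂ : HasMonotonePath A v q r L')
    (hL : 0 ≤ L) (hL' : 0 ≤ L') : HasMonotonePath A v p r (L + L') := by
  obtain ⟨γ₁, hc₁, hp₁, hq₁, hA₁, hm₁, hl₁⟩ := h₁
  obtain ⟨γ₂, hc₂, hp₂, hq₂, hA₂, hm₂, hl₂⟩ := h₂
  set γ : ℝ → Plane := fun t => if t ≤ 1 / 2 then γ₁ (2 * t) else γ₂ (2 * t - 1) with hγ
  have e₁ : EqOn γ (γ₁ ∘ fun t => 2 * t) (Icc 0 (1 / 2)) := fun t ht => if_pos ht.2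
  have e₂ : EqOn γ (γ₂ ∘ fun t => 2 * t - 1) (Icc (1 / 2) 1) := fun t ht => by
    rcases ht.1.eq_or_lt with rfl | h
    · simp [hγ, hq₁, hp₂]
    · exact if_neg h.not_ge
  have m₁ : MapsTo (fun t : ℝ => 2 * t) (Icc 0 (1 / 2)) (Icc 0 1) := fun t ht => by
    constructor <;> linarith [ht.1, ht.2]
  have m₂ : MapsTo (fun t : ℝ => 2 * t - 1) (Icc (1 / 2) 1) (Icc 0 1) := fun t ht => by
    constructor <;> linarith [ht.1, ht.2]
  have mo₁ : MonotoneOn (fun t : ℝ => 2 * t) (Icc 0 (1 / 2)) := fun x _ y _ h => by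
    simp only; linarith
  have mo₂ : MonotoneOn (fun t : ℝ => 2 * t - 1) (Icc (1 / 2) 1) := fun x _ y _ h => by
    simp only; linarith
  have hu : Icc (0 : ℝ) 1 = Icc 0 (1 / 2) ∪ Icc (1 / 2) 1 :=
    (Icc_union_Icc_eq_Icc (by norm_num) (by norm_num)).symm
  refine ⟨γ, ?_, ?_, ?_, ?_, ?_, ?_⟩
  · rw [hu]
    exact ((hc₁.comp (by fun_prop) m₁).congr e₁).union_of_isClosed
      ((hc₂.comp (by fun_prop) m₂).congr e₂) isClosed_Icc isClosed_Icc
  · simp [hγ, hp₁]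
  · simp only [hγ]; norm_num [hq₂]
  · intro t ht
    rcases lt_or_ge t (1 / 2) with h | h
    · rw [e₁ ⟨ht.1, h.le⟩]
      exact hA₁ ⟨by linarith [ht.1], by linarith⟩
    · rw [e₂ ⟨h, ht.2.le⟩]
      exact hA₂ ⟨by linarith, by linarith [ht.2]⟩
  · rw [hu]
    refine MonotoneOn.union_right (c := 1 / 2) ?_ ?_ (isGreatest_Icc (by norm_num))
      (isLeast_Icc (by norm_num))
    · intro x hx y hy h
      simp only [e₁ hx, e₁ hy]
      exact hm₁ (m₁ hx) (m₁ hy) (mo₁ hx hy h)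
    · intro x hx y hy h
      simp only [e₂ hx, e₂ hy]
      exact hm₂ (m₂ hx) (m₂ hy) (mo₂ hx hy h)
  · have hs := eVariationOn.union γ (isGreatest_Icc (show (0 : ℝ) ≤ 1 / 2 by norm_num))
      (isLeast_Icc (show (1 / 2 : ℝ) ≤ 1 by norm_num))
    rw [pathLen, hu, hs, ENNReal.ofReal_add hL hL', eVariationOn.congr e₁, eVariationOn.congr e₂]
    exact add_le_add ((eVariationOn.comp_le_of_monotoneOn _ _ mo₁ m₁).trans hl₁)
      ((eVariationOn.comp_le_of_monotoneOn _ _ mo₂ m₂).trans hl₂)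

end HasMonotonePath

lemma exists_add_smul_mem_frontier {P : Set Plane} (hP : IsCompact P) {p v : Plane}
    (hp : p ∈ P) (hv : ‖v‖ = 1) : ∃ τ : ℝ, 0 ≤ τ ∧ p + τ • v ∈ frontier P := by
  have hcont : Continuous fun τ : ℝ => p + τ • v := by fun_prop
  have hcomp : IsCompact (Icc 0 (diam P) ∩ (fun τ : ℝ => p + τ • v) ⁻¹' P) :=
    isCompact_Icc.inter_right (hP.isClosed.preimage hcont)
  obtain ⟨τ, hτ, hmax⟩ := hcomp.exists_isGreatest ⟨0, ⟨le_rfl, diam_nonneg⟩, by simpa using hp⟩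
  refine ⟨τ, hτ.1.1, subset_closure hτ.2, fun hint => ?_⟩
  have hnear : (fun τ : ℝ => p + τ • v) ⁻¹' interior P ∈ nhds τ :=
    (isOpen_interior.preimage hcont).mem_nhds hint
  obtain ⟨η, hη, hball⟩ := Metric.mem_nhds_iff.1 hnear
  have hmem : p + (τ + η / 2) • v ∈ P := interior_subset <| hball <| by
    rw [mem_ball, Real.dist_eq]; rw [abs_lt]; constructor <;> linarith
  have hd := dist_le_diam_of_mem hP.isBounded hmem hp
  rw [dist_eq_norm, add_sub_cancel_left, norm_smul, hv, mul_one, Real.norm_eq_abs] at hd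
  have h := hmax ⟨⟨by linarith [hτ.1.1], (le_abs_self _).trans hd⟩, hmem⟩
  linarith

/-- Greedy escape: move in direction `v`, and slide along each segment met to its higher endpoint.
The length is controlled by the potential `K * (height left) + ∑ (cost of the segments left)`. -/
lemma exists_hasMonotonePath_frontier {ι : Type*} [DecidableEq ι] [Finite ι] {P : Set Plane}
    (hPc : Convex ℝ P) (hP : IsCompact P) {v : Plane} (hv : ‖v‖ = 1) {a b d : ι → Plane}
    {cost : ι → ℝ} {K M : ℝ} (hK : 1 ≤ K)
    (hdisj : Pairwise fun i j => Disjoint (segment ℝ (a i) (b i)) (segment ℝ (a j) (b j)))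
    (hsub : ∀ i, segment ℝ (a i) (b i) ⊆ interior P)
    (hd : ∀ i, ∃ l : ℝ, 0 ≤ l ∧ b i - a i = l • d i) (hdv : ∀ i, 0 < ⟪d i, v⟫)
    (hpar : ∀ i (x : ℝ), x • d i ≠ v) (hcost₀ : ∀ i, 0 ≤ cost i)
    (hcost : ∀ i, ‖b i - a i‖ ≤ K * ⟪b i - a i, v⟫ + cost i) (hM : ∀ x ∈ P, ⟪x, v⟫ ≤ M)
    (F : Finset ι) : ∀ ε : ℝ, 0 < ε → ∀ p ∈ P \ ⋃ i, segment ℝ (a i) (b i),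
      (∀ i ∉ F, ⟪b i, v⟫ < ⟪p, v⟫) →
      ∃ q ∈ frontier P, HasMonotonePath (P \ ⋃ i, segment ℝ (a i) (b i)) v p q
        (K * (M - ⟪p, v⟫) + ∑ i ∈ F, cost i + ε) := by
  have hcS : IsClosed (⋃ i, segment ℝ (a i) (b i)) := isClosed_iUnion_of_finite fun i => by
    rw [← convexHull_pair]
    exact ((toFinite _).isCompact_convexHull ℝ).isClosed
  have hvv : ⟪v, v⟫ = (1 : ℝ) := by rw [real_inner_self_eq_norm_sq, hv, one_pow]
  induction F using Finset.strongInduction with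
  | H F ih =>
  intro ε hε p hp hF
  obtain ⟨T, hT, hTf⟩ := exists_add_smul_mem_frontier hP hp.1 hv
  have hTP : p + T • v ∈ P := hP.isClosed.frontier_subset hTf
  have hray : ∀ τ ∈ Icc 0 T, p + τ • v ∈ P := fun τ hτ => by
    rcases hT.eq_or_lt with rfl | hT'
    · obtain rfl : τ = 0 := le_antisymm hτ.2 hτ.1
      exact hTP
    · have h := hPc.add_smul_sub_mem hp.1 hTP
        (t := τ / T) ⟨div_nonneg hτ.1 hT, div_le_one_of_le₀ hτ.2 hT⟩
      rwa [add_sub_cancel_left, smul_smul, div_mul_cancel₀ _ hT'.ne'] at h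
  have hup : ∀ τ : ℝ, 0 ≤ τ → (∀ t ∈ Ico 0 τ, p + t • v ∈ P \ ⋃ i, segment ℝ (a i) (b i)) →
      HasMonotonePath (P \ ⋃ i, segment ℝ (a i) (b i)) v p (p + τ • v) τ := fun τ hτ h => by
    have hs := HasMonotonePath.of_segment (A := P \ ⋃ i, segment ℝ (a i) (b i)) (v := v) (p := p)
      (q := p + τ • v) (fun t ht => ?_) ?_
    · rwa [add_sub_cancel_left, norm_smul, hv, mul_one, Real.norm_of_nonneg hτ] at hs
    · rw [add_sub_cancel_left, smul_smul]
      rcases hτ.eq_or_lt with rfl | hτ'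
      · simpa using hp
      · exact h _ ⟨mul_nonneg ht.1 hτ, by nlinarith [ht.2]⟩
    · rw [add_sub_cancel_left, real_inner_smul_left, hvv, mul_one]
      exact hτ
  have hcostF : 0 ≤ ∑ i ∈ F, cost i := Finset.sum_nonneg fun i _ => hcost₀ i
  have hhits : IsCompact (Icc 0 T ∩ (fun τ : ℝ => p + τ • v) ⁻¹' ⋃ i, segment ℝ (a i) (b i)) :=
    isCompact_Icc.inter_right (hcS.preimage (by fun_prop))
  rcases (Icc 0 T ∩ (fun τ : ℝ => p + τ • v) ⁻¹' ⋃ i, segment ℝ (a i) (b i)).eq_empty_or_nonempty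
    with hemp | hne
  · refine ⟨_, hTf, (hup T hT fun t ht => ⟨hray t ⟨ht.1, ht.2.le⟩, fun hmem => ?_⟩).mono_length ?_⟩
    · exact eq_empty_iff_forall_notMem.1 hemp t ⟨⟨ht.1, ht.2.le⟩, hmem⟩
    · have h := hM _ hTP
      rw [inner_add_left, real_inner_smul_left, hvv] at h
      nlinarith
  obtain ⟨τ, ⟨hτT, hτS⟩, hτmin⟩ := hhits.exists_isLeast hne
  have hτ₀ : 0 < τ := hτT.1.lt_of_ne fun h => hp.2 (by subst h; simpa using hτS)
  obtain ⟨i, hi⟩ := mem_iUnion.1 hτS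
  set q := p + τ • v with hq
  replace hi : q ∈ segment ℝ (a i) (b i) := hi
  obtain ⟨l, hl, hlq⟩ := hd i
  obtain ⟨μ, hμ, hμq⟩ : ∃ μ ∈ Icc (0 : ℝ) 1, b i - q = μ • (b i - a i) := by
    obtain ⟨x, y, hx, hy, hxy, hxq⟩ := hi
    refine ⟨x, ⟨hx, by linarith⟩, ?_⟩
    rw [← hxq, show y = 1 - x by linarith]
    module
  have hqv : ⟪q, v⟫ = ⟪p, v⟫ + τ := by
    rw [hq, inner_add_left, real_inner_smul_left, hvv, mul_one]
  have hbq : ⟪b i, v⟫ = ⟪q, v⟫ + μ * l * ⟪d i, v⟫ := by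
    have h : b i = q + (μ * l) • d i := by rw [mul_smul, ← hlq, ← hμq]; abel
    rw [h, inner_add_left, real_inner_smul_left]
  have hml : 0 ≤ μ * l := mul_nonneg hμ.1 hl
  have hiF : i ∈ F := by
    by_contra h
    have := hF i h
    nlinarith [hdv i, mul_nonneg hml (hdv i).le]
  -- room around the segment that is hit
  have hopen : IsOpen (interior P \ ⋃ j : {j // j ≠ i}, segment ℝ (a j) (b j)) :=
    isOpen_interior.sdiff <| isClosed_iUnion_of_finite fun j => by
      rw [← convexHull_pair]
      exact ((toFinite _).isCompact_convexHull ℝ).isClosed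
  have hScomp : IsCompact (segment ℝ (a i) (b i)) := by
    rw [← convexHull_pair]
    exact (toFinite _).isCompact_convexHull ℝ
  obtain ⟨ρ, hρ, hthick⟩ := hScomp.exists_thickening_subset_open hopen fun x hx =>
    ⟨hsub i hx, fun hx' => by
      obtain ⟨j, hj⟩ := mem_iUnion.1 hx'
      exact (hdisj j.2).le_bot ⟨hj, hx⟩⟩
  set k := ‖d i‖ / ⟪d i, v⟫ with hk
  have hk₀ : 0 ≤ k := div_nonneg (norm_nonneg _) (hdv i).le
  obtain ⟨δ, hδ, hδτ, hδρ, hδε⟩ : ∃ δ : ℝ, 0 < δ ∧ δ < τ ∧ δ * (1 + 2 * k) < ρ ∧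
      δ * (1 + 2 * k) < ε / 2 := by
    refine ⟨min (τ / 2) (min ρ (ε / 2) / (2 * (1 + 2 * k))), by positivity,
      (min_le_left _ _).trans_lt (by linarith), ?_⟩
    rw [← lt_min_iff]
    have h0 : 0 < min ρ (ε / 2) := by positivity
    calc _ ≤ min ρ (ε / 2) / (2 * (1 + 2 * k)) * (1 + 2 * k) := by
          gcongr; exact min_le_right _ _
      _ = min ρ (ε / 2) / 2 := by field_simp
      _ < _ := by linarith
  set m := p + (τ - δ) • v with hm
  set x := 2 * δ / ⟪d i, v⟫ with hx
  have hx₀ : 0 ≤ x := div_nonneg (by linarith) (hdv i).le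
  have hxd : x * ⟪d i, v⟫ = 2 * δ := div_mul_cancel₀ _ (hdv i).ne'
  have hxn : x * ‖d i‖ = 2 * δ * k := by rw [hx, hk]; ring
  have hmq : m = q - δ • v := by rw [hm, hq]; module
  -- the line parallel to the hit segment
  have hslide : ∀ y ∈ Icc 0 (μ * l + x), m + y • d i ∈ P \ ⋃ i, segment ℝ (a i) (b i) := by
    intro y hy
    obtain ⟨z, hz, hzd⟩ : ∃ z ∈ segment ℝ (a i) (b i), dist (m + y • d i) z < ρ := by
      have hmin : q + min y (μ * l) • d i ∈ segment ℝ (q) (b i) := by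
        rcases hml.eq_or_lt with h | h
        · rw [← h, min_eq_right hy.1, zero_smul, add_zero]
          exact left_mem_segment ℝ _ _
        · rw [segment_eq_image']
          refine ⟨min y (μ * l) / (μ * l), ⟨div_nonneg (le_min hy.1 hml) hml,
            div_le_one_of_le₀ (min_le_right _ _) hml⟩, ?_⟩
          simp only
          rw [hμq, hlq, smul_smul, smul_smul, mul_assoc, div_mul_cancel₀ _ h.ne']
      refine ⟨_, (convex_segment (a i) (b i)).segment_subset hi (right_mem_segment ℝ _ _) hmin, ?_⟩
      have he : m + y • d i - (q + min y (μ * l) • d i) = (y - min y (μ * l)) • d i - δ • v := by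
        rw [hmq]; module
      rw [dist_eq_norm, he]
      refine (norm_sub_le _ _).trans_lt ?_
      rw [norm_smul, norm_smul, hv, Real.norm_of_nonneg hδ.le,
        Real.norm_of_nonneg (sub_nonneg.2 (min_le_left _ _))]
      have h1 : y - min y (μ * l) ≤ x := by
        rcases min_choice y (μ * l) with h | h <;> rw [h] <;> linarith [hy.2]
      have h2 := mul_le_mul_of_nonneg_right h1 (norm_nonneg (d i))
      linarith
    have hin := hthick (mem_thickening_iff.2 ⟨z, hz, hzd⟩)
    refine ⟨interior_subset hin.1, fun hmem => ?_⟩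
    obtain ⟨j, hj⟩ := mem_iUnion.1 hmem
    by_cases hji : j = i
    · subst hji
      rw [segment_eq_image'] at hj hi
      obtain ⟨s, _, hs⟩ := hj
      obtain ⟨s', _, hs'⟩ := hi
      simp only at hs hs'
      have h : δ • v = (y + s' * l - s * l) • d j := by
        have h1 : δ • v = q - m := by rw [hmq]; abel
        have h2 : m = a j + s • (b j - a j) - y • d j := by rw [hs]; abel
        rw [h1, h2, ← hs', hlq]; module
      refine hpar j (δ⁻¹ * (y + s' * l - s * l)) ?_
      rw [mul_smul, ← h, smul_smul, inv_mul_cancel₀ hδ.ne', one_smul]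
    · exact hin.2 (mem_iUnion.2 ⟨⟨j, hji⟩, hj⟩)
  set p' := m + (μ * l + x) • d i with hp'
  have hp'S := hslide _ ⟨by positivity, le_rfl⟩
  have hmv : ⟪m, v⟫ = ⟪q, v⟫ - δ := by
    rw [hmq, inner_sub_left, real_inner_smul_left, hvv, mul_one]
  have hp'v : ⟪p', v⟫ = ⟪b i, v⟫ + δ := by
    rw [hp', inner_add_left, real_inner_smul_left, hmv, hbq]
    linarith
  have hpath₁ := hup (τ - δ) (by linarith) fun t ht => ⟨hray t ⟨ht.1, by linarith [ht.2, hτT.2]⟩,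
    fun hmem => by
      have := hτmin ⟨⟨ht.1, by linarith [ht.2, hτT.2]⟩, hmem⟩
      linarith [ht.2]⟩
  have hpath₂ : HasMonotonePath (P \ ⋃ i, segment ℝ (a i) (b i)) v m p' ‖p' - m‖ := by
    refine HasMonotonePath.of_segment (fun t ht => ?_) ?_
    · rw [hp', add_sub_cancel_left, smul_smul]
      exact hslide _ ⟨mul_nonneg ht.1 (by positivity),
        mul_le_of_le_one_left (by positivity) ht.2.le⟩
    · rw [hp', add_sub_cancel_left, real_inner_smul_left]
      exact mul_nonneg (by positivity) (hdv i).le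
  obtain ⟨r, hr, hpath₃⟩ := ih (F.erase i) (Finset.erase_ssubset hiF) (ε / 2) (half_pos hε) p' hp'S
    fun j hj => by
      by_cases hji : j = i
      · subst hji
        linarith
      · have := hF j fun h => hj (Finset.mem_erase.2 ⟨hji, h⟩)
        nlinarith [mul_nonneg hml (hdv i).le]
  have hlen : ‖p' - m‖ ≤ K * ⟪b i - q, v⟫ + cost i + 2 * δ * k := by
    have h1 : p' - m = μ • (b i - a i) + x • d i := by
      rw [hp', add_sub_cancel_left, add_smul, mul_smul, hlq]
    have h2 : K * ⟪b i - q, v⟫ = μ * (K * ⟪b i - a i, v⟫) := by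
      rw [hμq, real_inner_smul_left]; ring
    rw [h1, h2, ← hxn]
    refine (norm_add_le _ _).trans ?_
    rw [norm_smul, norm_smul, Real.norm_of_nonneg hμ.1, Real.norm_of_nonneg hx₀]
    have h3 := mul_le_mul_of_nonneg_left (hcost i) hμ.1
    have h4 := mul_le_of_le_one_left (hcost₀ i) hμ.2
    linarith
  have hsum : ∑ j ∈ F.erase i, cost j + cost i = ∑ j ∈ F, cost j := Finset.sum_erase_add _ _ hiF
  refine ⟨r, hr, ((hpath₁.trans hpath₂ (by linarith) (norm_nonneg _)).trans hpath₃
    (add_nonneg (by linarith) (norm_nonneg _)) ?_).mono_length ?_⟩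
  · have h1 := hM _ hp'S.1
    have h2 : 0 ≤ ∑ j ∈ F.erase i, cost j := Finset.sum_nonneg fun j _ => hcost₀ j
    nlinarith [mul_nonneg (zero_le_one.trans hK) (sub_nonneg.2 h1)]
  · rw [inner_sub_left] at hlen
    rw [hp'v]
    have hKτ : τ ≤ K * τ := le_mul_of_one_le_left hτ₀.le hK
    have hKδ : 0 ≤ K * δ := by positivity
    have e : K * ⟪q, v⟫ = K * ⟪p, v⟫ + K * τ := by rw [hqv]; ring
    linarith

lemma norm_sq_eq_coord (z : Plane) : ‖z‖ ^ 2 = z 0 ^ 2 + z 1 ^ 2 := by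
  rw [EuclideanSpace.real_norm_sq_eq, Fin.sum_univ_two]

/-- The slopes in `[0, 1]` almost perpendicular to a given vector form a set of small measure. -/
lemma volume_real_nearly_perpendicular_le (z : Plane) {c : ℝ} (hc : 0 < c) (hc' : c ≤ 1 / 4) :
    (volume.restrict (Icc (0 : ℝ) 1)).real {m | |z 0 + m * z 1| < c * ‖z‖} ≤ 4 * c := by
  have hn := norm_sq_eq_coord z
  rw [measureReal_restrict_apply (isOpen_lt (by fun_prop) (by fun_prop)).measurableSet]
  rcases lt_or_ge |z 1| (‖z‖ / 2) with h | h
  · have hemp : {m | |z 0 + m * z 1| < c * ‖z‖} ∩ Icc 0 1 = (∅ : Set ℝ) := by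
      refine eq_empty_of_forall_notMem fun m ⟨hm, hm₀, hm₁⟩ => ?_
      have hz0 : |z 0| < 3 / 4 * ‖z‖ := by
        have h1 : |z 0| ≤ |z 0 + m * z 1| + |m * z 1| := by
          simpa using abs_sub (z 0 + m * z 1) (m * z 1)
        have h2 : |m * z 1| ≤ |z 1| := by
          rw [abs_mul, abs_of_nonneg hm₀]
          exact mul_le_of_le_one_left (abs_nonneg _) hm₁
        have h3 : c * ‖z‖ ≤ 1 / 4 * ‖z‖ := by gcongr
        have hm' : |z 0 + m * z 1| < c * ‖z‖ := hm
        linarith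
      have h4 := pow_lt_pow_left₀ hz0 (abs_nonneg _) two_ne_zero
      have h5 := pow_lt_pow_left₀ h (abs_nonneg _) two_ne_zero
      rw [sq_abs] at h4 h5
      nlinarith [sq_nonneg ‖z‖]
    rw [hemp]
    simp only [measureReal_empty]
    positivity
  · rcases eq_or_ne z 0 with rfl | hz
    · simp only [PiLp.zero_apply, norm_zero, mul_zero, add_zero, abs_zero, lt_self_iff_false,
        ofPred_false, empty_inter, measureReal_empty]
      positivity
    have hz' : 0 < ‖z‖ := norm_pos_iff.2 hz
    have hz1 : 0 < |z 1| := by linarith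
    have hz1' : z 1 ≠ 0 := abs_pos.1 hz1
    have hsub : {m | |z 0 + m * z 1| < c * ‖z‖} ∩ Icc 0 1 ⊆
        Icc (-z 0 / z 1 - 2 * c) (-z 0 / z 1 + 2 * c) := fun m ⟨hm, _⟩ => by
      have h1 : z 0 + m * z 1 = (m - -z 0 / z 1) * z 1 := by field_simp; ring
      have h2 : |m - -z 0 / z 1| * |z 1| < c * ‖z‖ := by
        rw [← abs_mul, ← h1]
        exact hm
      have h3 : |m - -z 0 / z 1| ≤ 2 * c := by
        by_contra! h3
        nlinarith
      have h4 := abs_le.1 h3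
      constructor <;> linarith [h4.1, h4.2]
    calc _ ≤ volume.real (Icc (-z 0 / z 1 - 2 * c) (-z 0 / z 1 + 2 * c)) :=
          measureReal_mono hsub measure_Icc_lt_top.ne
      _ = 4 * c := by rw [Real.volume_real_Icc_of_le (by linarith)]; ring

lemma finite_setOf_add_mul_eq_zero {x y : ℝ} (h : x ≠ 0 ∨ y ≠ 0) :
    {m : ℝ | x + m * y = 0}.Finite := by
  refine Set.Subsingleton.finite fun m hm m' hm' => ?_
  have hm₀ : x + m * y = 0 := hm
  have hm₀' : x + m' * y = 0 := hm'
  by_cases hy : y = 0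
  · subst hy
    simp_all
  · have : (m - m') * y = 0 := by linear_combination hm₀ - hm₀'
    exact sub_eq_zero.1 ((mul_eq_zero.1 this).resolve_right hy)

/-- Some generic slope is almost perpendicular only to vectors of small total length. -/
lemma exists_slope {ι : Type*} [Fintype ι] (z : ι → Plane) {c : ℝ} (hc : 0 < c)
    (hc' : c ≤ 1 / 4) : ∃ m ∈ Icc (0 : ℝ) 1,
      (∀ i, z i ≠ 0 → z i 0 + m * z i 1 ≠ 0 ∧ z i 1 - m * z i 0 ≠ 0) ∧
      ∑ i, (if |z i 0 + m * z i 1| < c * ‖z i‖ then ‖z i‖ else 0) ≤ 4 * c * ∑ i, ‖z i‖ := by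
  set μ : Measure ℝ := volume.restrict (Icc (0 : ℝ) 1) with hμ
  have : IsProbabilityMeasure μ := ⟨by simp [hμ]⟩
  set B : ι → Set ℝ := fun i => {m | |z i 0 + m * z i 1| < c * ‖z i‖} with hB
  have hBm : ∀ i, MeasurableSet (B i) := fun i =>
    (isOpen_lt (by fun_prop) (by fun_prop)).measurableSet
  have hint : ∀ i, Integrable ((B i).indicator fun _ => ‖z i‖) μ := fun i =>
    (integrable_const _).indicator (hBm i)
  set E : Set ℝ := ⋃ i, {m | z i ≠ 0 ∧ (z i 0 + m * z i 1 = 0 ∨ z i 1 + m * -z i 0 = 0)} with hE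
  have hEfin : E.Finite := finite_iUnion fun i => by
    by_cases hz : z i = 0
    · simp [hz]
    have hne : z i 0 ≠ 0 ∨ z i 1 ≠ 0 := by
      by_contra! h
      exact hz (by ext j; fin_cases j <;> simp [h])
    refine ((finite_setOf_add_mul_eq_zero hne).union (finite_setOf_add_mul_eq_zero
      (hne.symm.imp_right neg_ne_zero.2))).subset fun m hm => hm.2
  have hnull : μ (E ∪ (Icc 0 1)ᶜ) = 0 :=
    measure_union_null (le_antisymm ((Measure.restrict_apply_le _ _).trans
      (hEfin.measure_zero _).le) bot_le) (by simp [hμ])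
  obtain ⟨m, hm, hle⟩ := exists_notMem_null_le_integral
    (f := fun m => ∑ i, (B i).indicator (fun _ => ‖z i‖) m)
    (integrable_finsetSum _ fun i _ => hint i) hnull
  rw [mem_union, not_or, notMem_compl_iff] at hm
  refine ⟨m, hm.2, fun i hi => ⟨fun h => hm.1 (mem_iUnion.2 ⟨i, hi, .inl h⟩),
    fun h => hm.1 (mem_iUnion.2 ⟨i, hi, .inr (by linarith)⟩)⟩, ?_⟩
  rw [integral_finsetSum _ fun i _ => hint i] at hle
  calc _ = ∑ i, (B i).indicator (fun _ => ‖z i‖) m := by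
        refine Finset.sum_congr rfl fun i _ => ?_
        simp only [indicator_apply, hB, mem_ofPred_eq]
    _ ≤ _ := hle
    _ ≤ ∑ i, 4 * c * ‖z i‖ := by
        refine Finset.sum_le_sum fun i _ => ?_
        rw [integral_indicator_const _ (hBm i), smul_eq_mul]
        exact mul_le_mul_of_nonneg_right (volume_real_nearly_perpendicular_le _ hc hc')
          (norm_nonneg _)
    _ = _ := (Finset.mul_sum _ _ _).symm

/-- A segment whose direction is neither orthogonal nor parallel to `v` can be oriented along `v`. -/
lemma exists_orientation {a b v : Plane} (hperp : b - a ≠ 0 → ⟪b - a, v⟫ ≠ 0)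
    (hpar : b - a ≠ 0 → ∀ x : ℝ, x • (b - a) ≠ v)
    (hgen : ∃ d : Plane, 0 < ⟪d, v⟫ ∧ ∀ x : ℝ, x • d ≠ v) :
    ∃ a' b' d : Plane, segment ℝ a' b' = segment ℝ a b ∧ ‖b' - a'‖ = ‖b - a‖ ∧
      ⟪b' - a', v⟫ = |⟪b - a, v⟫| ∧ (∃ l : ℝ, 0 ≤ l ∧ b' - a' = l • d) ∧ 0 < ⟪d, v⟫ ∧
      ∀ x : ℝ, x • d ≠ v := by
  by_cases hz : b - a = 0
  · obtain ⟨d, hd, hd'⟩ := hgen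
    exact ⟨a, b, d, rfl, rfl, by simp [hz], ⟨0, le_rfl, by simp [hz]⟩, hd, hd'⟩
  rcases (hperp hz).lt_or_gt with h | h
  · have hneg : ⟪a - b, v⟫ = -⟪b - a, v⟫ := by rw [← neg_sub, inner_neg_left]
    refine ⟨b, a, a - b, segment_symm ℝ b a, norm_sub_rev _ _, by rw [hneg, abs_of_neg h],
      ⟨1, zero_le_one, (one_smul _ _).symm⟩, by linarith, fun x hx => hpar hz (-x) ?_⟩
    rw [← hx, neg_smul, ← smul_neg, neg_sub]
  · exact ⟨a, b, b - a, rfl, rfl, (abs_of_pos h).symm, ⟨1, zero_le_one, (one_smul _ _).symm⟩, h,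
      hpar hz⟩

/-- There is an absolute constant `C > 0` with the following property.
For `h ≥ 1` and pairwise disjoint closed segments `Sᵢ = [aᵢ, bᵢ]` in the interior of a convex
polygon `P₀`, each of length at most `Δ·diam₂(P₀)` where `Δ ≥ 1/h`, from every point
`s ∈ P₀ \ ⋃ᵢ Sᵢ` and for every `ε > 0` there is a `v`-monotone continuous path (for some unit
vector `v`) from `s` to `frontier P₀`, avoiding all segments up to the final point, of length
at most `C·h^{1/2}·Δ^{1/2}·diam₂(P₀) + ε`. -/
theorem monotone_escape_path_segments :
    ∃ C : ℝ, 0 < C ∧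
      ∀ (h : ℕ), 1 ≤ h → ∀ (Δ : ℝ), 1 / (h : ℝ) ≤ Δ →
        ∀ (P₀ : Set Plane) (a b : Fin h → Plane),
          IsConvexPolygon P₀ →
          Pairwise (fun i j => Disjoint (segment ℝ (a i) (b i)) (segment ℝ (a j) (b j))) →
          (∀ i, segment ℝ (a i) (b i) ⊆ interior P₀) →
          (∀ i, dist (a i) (b i) ≤ Δ * Metric.diam P₀) →
          ∀ s ∈ (P₀ \ ⋃ i, segment ℝ (a i) (b i)), ∀ ε : ℝ, 0 < ε →
            ∃ (v : Plane) (γ : ℝ → Plane), ‖v‖ = 1 ∧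
              ContinuousOn γ (Set.Icc 0 1) ∧ γ 0 = s ∧ γ 1 ∈ frontier P₀ ∧
              Set.MapsTo γ (Set.Ico 0 1) (P₀ \ ⋃ i, segment ℝ (a i) (b i)) ∧
              MonotoneOn (fun t => ⟪γ t, v⟫) (Set.Icc 0 1) ∧
              pathLen γ ≤
                ENNReal.ofReal
                  (C * Real.sqrt h * Real.sqrt Δ * Metric.diam P₀ + ε) := by
  refine ⟨9, by norm_num, ?_⟩
  intro h hh Δ hΔ P a b hPoly hdisj hsub hlen s hs ε hε
  obtain ⟨S, -, rfl⟩ := hPoly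
  set P := convexHull ℝ (S : Set Plane)
  have hP : IsCompact P := S.finite_toSet.isCompact_convexHull ℝ
  set D := diam P
  have hD : 0 ≤ D := diam_nonneg
  have hh' : (0 : ℝ) < h := by exact_mod_cast hh
  have hΔ₀ : 0 < Δ := (by positivity : (0 : ℝ) < 1 / h).trans_le hΔ
  set σ := √h * √Δ with hσ
  have hσσ : σ * σ = h * Δ := by
    rw [hσ, mul_mul_mul_comm, Real.mul_self_sqrt hh'.le, Real.mul_self_sqrt hΔ₀.le]
  have hσ₁ : 1 ≤ σ := by
    rw [hσ, ← Real.sqrt_mul hh'.le, Real.one_le_sqrt, mul_comm]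
    exact (div_le_iff₀ hh').1 hΔ
  have hσ₀ : 0 < σ := by linarith
  set c := 1 / (4 * σ) with hc
  have hc₀ : 0 < c := by positivity
  have hc₁ : c ≤ 1 / 4 := one_div_le_one_div_of_le (by norm_num) (by linarith)
  obtain ⟨m, hm, hgen, hsum⟩ := exists_slope (fun i => b i - a i) hc₀ hc₁
  set w : Plane := !₂[1, m] with hw
  have hw₂ : ‖w‖ ^ 2 = 1 + m ^ 2 := by rw [norm_sq_eq_coord]; simp [hw]
  have hw₀ : 0 < ‖w‖ := (sq_pos_iff.1 (by rw [hw₂]; positivity)).symm.lt_of_le (norm_nonneg _)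
  have hw2 : ‖w‖ ≤ 2 := by nlinarith [hm.1, hm.2]
  have hinner : ∀ z : Plane, ⟪z, w⟫ = z 0 + m * z 1 := fun z => by
    simp [hw, PiLp.inner_apply, Fin.sum_univ_two]
  set v := ‖w‖⁻¹ • w with hv
  have hv₁ : ‖v‖ = 1 := norm_smul_inv_norm (𝕜 := ℝ) (norm_pos_iff.1 hw₀)
  have hinner' : ∀ z : Plane, ⟪z, v⟫ = (z 0 + m * z 1) / ‖w‖ := fun z => by
    rw [hv, real_inner_smul_right, hinner, inv_mul_eq_div]
  have hnpar : ∀ z : Plane, z 1 - m * z 0 ≠ 0 → ∀ x : ℝ, x • z ≠ v := fun z hz x hx => by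
    have h0 := congrArg (fun y : Plane => y 0) hx
    have h1 := congrArg (fun y : Plane => y 1) hx
    simp only [hv, hw, PiLp.smul_apply, smul_eq_mul, Matrix.cons_val_zero, Matrix.cons_val_one,
      mul_one] at h0 h1
    have hx₀ : x * (z 1 - m * z 0) = 0 := by linear_combination h1 - m * h0
    rcases mul_eq_zero.1 hx₀ with h | h
    · rw [h, zero_mul] at h0
      exact (inv_pos.2 hw₀).ne h0
    · exact hz h
  choose a' b' d hseg hnorm habs hd hdv hpar using fun i =>
    exists_orientation (a := a i) (b := b i) (v := v)
      (fun hz => by rw [hinner']; exact div_ne_zero (hgen i hz).1 hw₀.ne')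
      (fun hz => hnpar _ (hgen i hz).2)
      ⟨!₂[1, m + 1], by
        rw [hinner']
        have := hm.1
        simp only [Matrix.cons_val_zero, Matrix.cons_val_one]
        positivity, hnpar _ (by simp)⟩
  set cost : Fin h → ℝ := fun i => if |(b i - a i) 0 + m * (b i - a i) 1| < c * ‖b i - a i‖ then
    ‖b i - a i‖ else 0 with hcost
  have hcost₀ : ∀ i, 0 ≤ cost i := fun i => by
    simp only [hcost]
    split_ifs
    exacts [norm_nonneg _, le_rfl]
  have hcost₁ : ∀ i, ‖b' i - a' i‖ ≤ 8 * σ * ⟪b' i - a' i, v⟫ + cost i := fun i => by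
    rw [hnorm, habs, hinner', abs_div, abs_of_pos hw₀]
    simp only [hcost]
    split_ifs with hi
    · have : 0 ≤ 8 * σ * (|(b i - a i) 0 + m * (b i - a i) 1| / ‖w‖) := by positivity
      linarith
    · push Not at hi
      rw [add_zero, ← mul_div_assoc, le_div_iff₀ hw₀]
      have h1 : 8 * σ * (c * ‖b i - a i‖) = 2 * ‖b i - a i‖ := by rw [hc]; field_simp; ring
      have h2 := mul_le_mul_of_nonneg_left hi (by positivity : 0 ≤ 8 * σ)
      have h3 := mul_le_mul_of_nonneg_left hw2 (norm_nonneg (b i - a i))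
      linarith
  have hM : ∀ x ∈ P, ⟪x, v⟫ ≤ ⟪s, v⟫ + D := fun x hx => by
    have h1 := real_inner_le_norm (x - s) v
    rw [inner_sub_left, hv₁, mul_one, ← dist_eq_norm] at h1
    linarith [dist_le_diam_of_mem hP.isBounded hx hs.1]
  obtain ⟨q, hq, γ, hγ, hγ₀, hγ₁, hγA, hγm, hγl⟩ :=
    exists_hasMonotonePath_frontier (convex_convexHull ℝ _) hP hv₁ (a := a') (b := b')
      (K := 8 * σ) (by linarith) (by simpa only [hseg] using hdisj) (by simpa only [hseg] using hsub)
      hd hdv hpar hcost₀ hcost₁ hM Finset.univ ε hε s (by simpa only [hseg] using hs) (by simp)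
  refine ⟨v, γ, hv₁, hγ, hγ₀, hγ₁ ▸ hq, by simpa only [hseg] using hγA, hγm,
    hγl.trans (ENNReal.ofReal_le_ofReal ?_)⟩
  have htotal : ∑ i, ‖b i - a i‖ ≤ h * (Δ * D) := by
    have := Finset.sum_le_card_nsmul Finset.univ (fun i => ‖b i - a i‖) (Δ * D) fun i _ => by
      rw [← dist_eq_norm, dist_comm]
      exact hlen i
    simpa using this
  have hfin : ∑ i, cost i ≤ σ * D := by
    refine hsum.trans ((mul_le_mul_of_nonneg_left htotal (by positivity)).trans_eq ?_)
    rw [← mul_assoc (h : ℝ), ← hσσ, hc]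
    field_simp
  have e : 9 * √h * √Δ * D = 9 * σ * D := by rw [hσ]; ring
  rw [e, add_sub_cancel_left]
  linarith
end
end

section
/- Let C ⊆ ℝ² be a compact convex set with nonempty interior, and let a, b ∈ C with dist(a,b) = diam₂(C). Let H = {x ∈ ℝ² : ⟪x, u⟫ ≥ α} be a closed halfplane whose boundary line L = {x : ⟪x, u⟫ = α} intersects the interior of C but is disjoint from the closed segment [a, b] (so [a,b] lies outside H except possibly touching nothing of H's interior). Let p, q be the two endpoints of the segment L ∩ C. Then there exists a continuous path γ : [0,1] → ℝ² with γ(0) = p, γ(1) = q, image of γ contained in frontier(C) ∩ H, and length at most (4π√3/9)·dist(p,q). In particular this length is less than 2.42·dist(p,q). -/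
open Set Metric ENNReal RealInnerProductSpace

noncomputable section

/-- In the plane, an orthonormal pair computes the norm. -/
lemma Plane.norm_sq_eq_of_orthonormal {u v : Plane} (hu : ‖u‖ = 1) (hv : ‖v‖ = 1)
    (huv : ⟪v, u⟫ = 0) (x : Plane) : ‖x‖ ^ 2 = ⟪x, v⟫ ^ 2 + ⟪x, u⟫ ^ 2 := by
  have hon : Orthonormal ℝ ![v, u] := by
    rw [orthonormal_iff_ite]
    intro i j
    fin_cases i <;> fin_cases j <;> simp [hu, hv, huv, real_inner_comm v u]
  have hcard : Fintype.card (Fin 2) = Module.finrank ℝ Plane := by simp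
  let e := basisOfOrthonormalOfCardEqFinrank hon hcard
  have he : ⇑e = ![v, u] := coe_basisOfOrthonormalOfCardEqFinrank hon hcard
  have heo : Orthonormal ℝ e := by rw [he]; exact hon
  have h := (e.toOrthonormalBasis heo).sum_sq_norm_inner_left x
  simpa [Fin.sum_univ_two, he] using h.symm

/-- A unit vector of the plane has a unit vector orthogonal to it. -/
lemma Plane.exists_unit_orthogonal {u : Plane} (hu : ‖u‖ = 1) :
    ∃ v : Plane, ‖v‖ = 1 ∧ ⟪v, u⟫ = 0 := by
  have h1 : u 0 ^ 2 + u 1 ^ 2 = 1 := by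
    have := EuclideanSpace.norm_sq_eq u
    simp [hu, Fin.sum_univ_two] at this
    linarith
  refine ⟨!₂[-u 1, u 0], ?_, ?_⟩
  · rw [← sq_eq_sq₀ (norm_nonneg _) zero_le_one, EuclideanSpace.norm_sq_eq]
    simp [Fin.sum_univ_two]
    linarith
  · simp [PiLp.inner_apply, Fin.sum_univ_two]
    ring

/-- In a triangle, the angle opposite to a longest side is at least `π / 3`. -/
lemma two_mul_inner_le_of_norm_sub_ge {E : Type*} [NormedAddCommGroup E] [InnerProductSpace ℝ E]
    {x y : E} (hx : ‖x‖ ≤ ‖x - y‖) (hy : ‖y‖ ≤ ‖x - y‖) : 2 * ⟪x, y⟫ ≤ ‖x‖ * ‖y‖ := by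
  have h := norm_sub_sq_real x y
  rcases le_total ‖x‖ ‖y‖ with hxy | hxy <;> nlinarith [norm_nonneg x, norm_nonneg y]

/-- If the segment `[s, t]` on a line at distance `h` from the origin is seen from the origin
under an angle at least `π / 3`, then so is every larger segment `[P, Q]`. -/
lemma wide_angle_mono {s t h P Q : ℝ} (hh : 0 < h) (hPs : P ≤ s) (hPt : P ≤ t) (hsQ : s ≤ Q)
    (htQ : t ≤ Q)
    (hst : 2 * (s * t + h ^ 2) ≤ √(s ^ 2 + h ^ 2) * √(t ^ 2 + h ^ 2)) :
    √3 * (P * Q + h ^ 2) ≤ h * (Q - P) := by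
  have h3 : √3 ^ 2 = 3 := Real.sq_sqrt (by norm_num)
  have h3p : 0 < √3 := by positivity
  wlog hle : s ≤ t generalizing s t
  · exact this hPt hPs htQ hsQ (by rw [mul_comm t s, mul_comm (√_)]; exact hst) (le_of_not_ge hle)
  have key : √3 * (s * t + h ^ 2) ≤ h * (t - s) := by
    by_contra! hlt
    have h0 : 0 ≤ h * (t - s) := mul_nonneg hh.le (by linarith)
    have hdot : 0 < s * t + h ^ 2 := by
      by_contra! hneg
      nlinarith
    have hsq : (2 * (s * t + h ^ 2)) ^ 2 ≤ (s ^ 2 + h ^ 2) * (t ^ 2 + h ^ 2) := by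
      calc _ ≤ (√(s ^ 2 + h ^ 2) * √(t ^ 2 + h ^ 2)) ^ 2 := by gcongr
        _ = _ := by rw [mul_pow, Real.sq_sqrt (by positivity), Real.sq_sqrt (by positivity)]
    have := pow_lt_pow_left₀ hlt h0 two_ne_zero
    nlinarith
  have hst' : 0 ≤ √3 * t + h := by
    by_contra! hneg
    have : s * (√3 * t + h) ≥ t * (√3 * t + h) := mul_le_mul_of_nonpos_right hle hneg.le
    nlinarith [sq_nonneg t, mul_pos h3p (pow_pos hh 2), mul_nonneg h3p.le (sq_nonneg t)]
  have hPt' : √3 * (P * t + h ^ 2) ≤ h * (t - P) := by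
    nlinarith [mul_le_mul_of_nonneg_right hPs hst']
  have hP : √3 * P - h ≤ 0 := by
    by_contra! hpos
    have : t * (√3 * P - h) ≥ P * (√3 * P - h) := mul_le_mul_of_nonneg_right hPt hpos.le
    nlinarith [sq_nonneg P, mul_pos h3p (pow_pos hh 2), mul_nonneg h3p.le (sq_nonneg P)]
  nlinarith [mul_le_mul_of_nonpos_right htQ hP]

/-- The nearest-point projection onto a complete convex set exists and is nonexpansive. -/
lemma exists_lipschitzWith_one_projection {E : Type*} [NormedAddCommGroup E]
    [InnerProductSpace ℝ E] {K : Set E} (hne : K.Nonempty) (hK : IsComplete K)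
    (hconv : Convex ℝ K) :
    ∃ π : E → E, LipschitzWith 1 π ∧ ∀ y, π y ∈ K ∧ ∀ w ∈ K, ⟪y - π y, w - π y⟫ ≤ 0 := by
  have h (y : E) : ∃ z ∈ K, ∀ w ∈ K, ⟪y - z, w - z⟫ ≤ 0 := by
    obtain ⟨z, hz, hmin⟩ := exists_norm_eq_iInf_of_complete_convex hne hK hconv y
    exact ⟨z, hz, (norm_eq_iInf_iff_real_inner_le_zero hconv hz).1 hmin⟩
  choose π hπ hπ' using h
  refine ⟨π, LipschitzWith.of_dist_le_mul fun x y ↦ ?_, fun y ↦ ⟨hπ y, hπ' y⟩⟩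
  rw [NNReal.coe_one, one_mul, dist_eq_norm, dist_eq_norm]
  have h1 := hπ' x (π y) (hπ y)
  have h2 := hπ' y (π x) (hπ x)
  have h3 : ⟪x - y, π x - π y⟫ - ‖π x - π y‖ ^ 2
      = -⟪x - π x, π y - π x⟫ - ⟪y - π y, π x - π y⟫ := by
    rw [← real_inner_self_eq_norm_sq, ← neg_sub (π x) (π y), inner_neg_right, neg_neg,
      ← inner_sub_left, ← inner_sub_left]
    congr 1
    abel
  have h4 := real_inner_le_norm (x - y) (π x - π y)
  by_contra! hlt
  nlinarith [norm_nonneg (x - y), norm_nonneg (π x - π y)]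

/-- The circle with centre `o` and radius `r`, parametrized by the angle in the frame `(v, u)`. -/
def circlePath (o v u : Plane) (r θ : ℝ) : Plane :=
  o + (r * Real.cos θ) • v + (r * Real.sin θ) • u

lemma circlePath_dist_le {u v : Plane} (hu : ‖u‖ = 1) (hv : ‖v‖ = 1) (huv : ⟪v, u⟫ = 0)
    (o : Plane) {r : ℝ} (hr : 0 ≤ r) (s t : ℝ) :
    dist (circlePath o v u r s) (circlePath o v u r t) ≤ r * dist s t := by
  rw [Real.dist_eq, ← sq_le_sq₀ dist_nonneg (by positivity), dist_eq_norm,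
    Plane.norm_sq_eq_of_orthonormal hu hv huv, mul_pow, sq_abs]
  have hvu : ⟪u, v⟫ = 0 := by rw [real_inner_comm]; exact huv
  simp only [circlePath, inner_sub_left, inner_add_left, inner_smul_left, huv, hvu,
    real_inner_self_eq_norm_sq, hu, hv]
  have h := Real.one_sub_sq_div_two_le_cos (x := s - t)
  rw [Real.cos_sub] at h
  have hs := Real.sin_sq_add_cos_sq s
  have ht := Real.sin_sq_add_cos_sq t
  have hchord : (Real.cos s - Real.cos t) ^ 2 + (Real.sin s - Real.sin t) ^ 2 ≤ (s - t) ^ 2 := by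
    nlinarith
  have := mul_le_mul_of_nonneg_left hchord (sq_nonneg r)
  simp only [conj_trivial]
  nlinarith

/-- Points of `C` beyond a chord `[p, q]` that separates them from a diameter `[a, b]` of `C` see
the chord under an angle at least `π / 3`, hence lie in a disk having `[p, q]` as a chord. -/
lemma norm_sub_le_of_mem_cap {C : Set Plane} (hC : IsCompact C) (hconv : Convex ℝ C)
    {a b : Plane} (ha : a ∈ C) (hb : b ∈ C) (hdiam : dist a b = Metric.diam C)
    {u v : Plane} (hu : ‖u‖ = 1) (hv : ‖v‖ = 1) (huv : ⟪v, u⟫ = 0) {α : ℝ}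
    (haα : ⟪a, u⟫ < α) (hbα : ⟪b, u⟫ < α) {o : Plane} {k : ℝ} (hk : 0 < k)
    (hoα : ⟪o, u⟫ = α + k)
    (hchord : ∀ z ∈ C, ⟪z, u⟫ = α → |⟪z - o, v⟫| ≤ √3 * k)
    {x : Plane} (hx : x ∈ C) (hxα : α ≤ ⟪x, u⟫) : ‖x - o‖ ≤ 2 * k := by
  have h3 : √3 ^ 2 = 3 := Real.sq_sqrt (by norm_num)
  have h3p : 0 < √3 := by positivity
  rw [← sq_le_sq₀ (norm_nonneg _) (by positivity), Plane.norm_sq_eq_of_orthonormal hu hv huv]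
  rcases hxα.eq_or_lt with hxα | hxα
  · have h1 := abs_le.1 (hchord x hx hxα.symm)
    rw [inner_sub_left x o u, hoα, ← hxα]
    nlinarith
  have hscale (c : Plane) (hc : c ∈ C) (hcα : ⟪c, u⟫ < α) :
      ∃ l : ℝ, 0 < l ∧ ⟪l • (c - x), u⟫ = -(⟪x, u⟫ - α) ∧
        |⟪l • (c - x), v⟫ + ⟪x - o, v⟫| ≤ √3 * k := by
    have hpos : 0 < ⟪x, u⟫ - ⟪c, u⟫ := by linarith
    have hl1 : (⟪x, u⟫ - α) / (⟪x, u⟫ - ⟪c, u⟫) ≤ 1 := by rw [div_le_one hpos]; linarith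
    set l := (⟪x, u⟫ - α) / (⟪x, u⟫ - ⟪c, u⟫) with hl
    have hl0 : 0 < l := div_pos (by linarith) hpos
    have hlu : ⟪l • (c - x), u⟫ = -(⟪x, u⟫ - α) := by
      rw [inner_smul_left, inner_sub_left, hl]
      simp only [conj_trivial]
      field_simp
      ring
    refine ⟨l, hl0, hlu, ?_⟩
    have hmem := hconv.add_smul_sub_mem hx hc ⟨hl0.le, hl1⟩
    have := hchord _ hmem (by rw [inner_add_left, hlu]; ring)
    rwa [← inner_add_left, show l • (c - x) + (x - o) = x + l • (c - x) - o by abel]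
  obtain ⟨l, hl, hlu, hlv⟩ := hscale a ha haα
  obtain ⟨m, hm, hmu, hmv⟩ := hscale b hb hbα
  have hangle : 2 * ⟪a - x, b - x⟫ ≤ ‖a - x‖ * ‖b - x‖ := by
    have hab : ‖a - x - (b - x)‖ = Metric.diam C := by
      rw [sub_sub_sub_cancel_right, ← dist_eq_norm, hdiam]
    apply two_mul_inner_le_of_norm_sub_ge <;> rw [hab, ← dist_eq_norm]
    · exact Metric.dist_le_diam_of_mem hC.isBounded ha hx
    · exact Metric.dist_le_diam_of_mem hC.isBounded hb hx
  have hangle' : 2 * ⟪l • (a - x), m • (b - x)⟫ ≤ ‖l • (a - x)‖ * ‖m • (b - x)‖ := by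
    rw [norm_smul, norm_smul, inner_smul_left, inner_smul_right, Real.norm_of_nonneg hl.le,
      Real.norm_of_nonneg hm.le]
    simp only [conj_trivial]
    nlinarith [mul_le_mul_of_nonneg_left hangle (mul_pos hl hm).le]
  have hnorm := Plane.norm_sq_eq_of_orthonormal hu hv huv
  set A := l • (a - x)
  set B := m • (b - x)
  have hinner : ⟪A, B⟫ = ⟪A, v⟫ * ⟪B, v⟫ + (⟪x, u⟫ - α) ^ 2 := by
    have h1 := hnorm (A + B)
    rw [norm_add_sq_real, hnorm A, hnorm B, inner_add_left, inner_add_left, hlu, hmu] at h1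
    linarith
  have hA : ‖A‖ = √(⟪A, v⟫ ^ 2 + (⟪x, u⟫ - α) ^ 2) := by
    rw [← Real.sqrt_sq (norm_nonneg A), hnorm A, hlu, neg_sq]
  have hB : ‖B‖ = √(⟪B, v⟫ ^ 2 + (⟪x, u⟫ - α) ^ 2) := by
    rw [← Real.sqrt_sq (norm_nonneg B), hnorm B, hmu, neg_sq]
  rw [hinner, hA, hB] at hangle'
  rw [abs_le] at hlv hmv
  have hwide := wide_angle_mono (P := -(√3 * k) - ⟪x - o, v⟫) (Q := √3 * k - ⟪x - o, v⟫)
    (sub_pos.2 hxα) (by linarith) (by linarith) (by linarith) (by linarith) hangle'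
  rw [inner_sub_left x o u, hoα]
  have hfin : √3 * ((-(√3 * k) - ⟪x - o, v⟫) * (√3 * k - ⟪x - o, v⟫) + (⟪x, u⟫ - α) ^ 2)
      ≤ √3 * (2 * k * (⟪x, u⟫ - α)) := by linarith
  have := le_of_mul_le_mul_left hfin h3p
  nlinarith

/-- Let `C` be a compact convex set with nonempty interior, `a, b ∈ C` with
`dist a b = diam₂ C`. Let `L = {x : ⟪x, u⟫ = α}` be a line meeting the interior of `C` but
disjoint from the segment `[a,b]`, which lies strictly on the other side of `L` from the
halfplane `H = {x : ⟪x, u⟫ ≥ α}`. If `p, q` are the endpoints of `L ∩ C`, then there is a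
continuous path from `p` to `q` in `frontier C ∩ H` of length at most
`(4π√3/9)·dist p q < 2.42·dist p q`. -/
theorem boundary_arc_length_bound
    (C : Set Plane) (hC : IsCompact C) (hconv : Convex ℝ C)
    (hint : (interior C).Nonempty)
    (a b : Plane) (ha : a ∈ C) (hb : b ∈ C) (hdiam : dist a b = Metric.diam C)
    (u : Plane) (hu : ‖u‖ = 1) (α : ℝ)
    (hmeets : ∃ x ∈ interior C, ⟪x, u⟫ = α)
    (hside : ∀ x ∈ segment ℝ a b, ⟪x, u⟫ < α)
    (p q : Plane)
    (hpq : {x ∈ C | ⟪x, u⟫ = α} = segment ℝ p q) :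
    ∃ γ : ℝ → Plane,
      ContinuousOn γ (Set.Icc 0 1) ∧ γ 0 = p ∧ γ 1 = q ∧
      Set.MapsTo γ (Set.Icc 0 1) (frontier C ∩ {x | α ≤ ⟪x, u⟫}) ∧
      pathLen γ ≤ ENNReal.ofReal (4 * Real.pi * Real.sqrt 3 / 9 * dist p q) ∧
      pathLen γ < ENNReal.ofReal (2.42 * dist p q) := by
  have hconvK : Convex ℝ (C ∩ {x | α ≤ ⟪x, u⟫}) := by
    refine hconv.inter fun x hx y hy s t hs ht hst ↦ ?_
    simp only [Set.mem_ofPred_eq, inner_add_left, inner_smul_left, conj_trivial] at hx hy ⊢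
    calc α = s * α + t * α := by rw [← add_mul, hst, one_mul]
      _ ≤ _ := by gcongr
  have hKc : IsCompact (C ∩ {x | α ≤ ⟪x, u⟫}) :=
    hC.inter_right (isClosed_le continuous_const (by fun_prop))
  have hp : p ∈ C ∧ ⟪p, u⟫ = α := by
    have := left_mem_segment ℝ p q
    rwa [← hpq] at this
  have hq : q ∈ C ∧ ⟪q, u⟫ = α := by
    have := right_mem_segment ℝ p q
    rwa [← hpq] at this
  have hne : p ≠ q := by
    rintro rfl
    obtain ⟨x, hx, hxα⟩ := hmeets
    obtain ⟨w, hw, hwu⟩ := Plane.exists_unit_orthogonal hu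
    obtain ⟨ε, hε, hball⟩ := Metric.mem_nhds_iff.1 (mem_interior_iff_mem_nhds.1 hx)
    have h1 : x ∈ segment ℝ p p := hpq ▸ ⟨interior_subset hx, hxα⟩
    have h2 : x + (ε / 2) • w ∈ segment ℝ p p := by
      rw [← hpq]
      refine ⟨hball ?_, ?_⟩
      · rw [mem_ball_iff_norm, add_sub_cancel_left, norm_smul, hw,
          Real.norm_of_nonneg (by positivity)]
        linarith
      · rw [inner_add_left, inner_smul_left, hwu, hxα]
        simp
    rw [segment_same, Set.mem_singleton_iff] at h1 h2
    have h3 : (ε / 2) • w = 0 := by simpa [h1] using h2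
    have h4 : ‖(ε / 2) • w‖ = ε / 2 := by
      rw [norm_smul, hw, Real.norm_of_nonneg (by positivity), mul_one]
    rw [h3, norm_zero] at h4
    linarith
  have hℓ : 0 < dist p q := dist_pos.2 hne
  set ℓ := dist p q with hℓdef
  set v : Plane := ℓ⁻¹ • (q - p) with hvdef
  set k : ℝ := √3 / 6 * ℓ with hkdef
  set o : Plane := p + (√3 * k) • v + k • u with hodef
  have h3 : √3 ^ 2 = 3 := Real.sq_sqrt (by norm_num)
  have hk : 0 < k := by positivity
  have hkℓ : 2 * (√3 * k) = ℓ := by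
    rw [hkdef]
    linear_combination ℓ / 3 * h3
  have hv : ‖v‖ = 1 := by
    rw [hvdef, norm_smul, ← dist_eq_norm, dist_comm, Real.norm_of_nonneg (by positivity),
      ← hℓdef, inv_mul_cancel₀ hℓ.ne']
  have huv : ⟪v, u⟫ = 0 := by
    rw [hvdef, inner_smul_left, inner_sub_left, hp.2, hq.2]
    simp
  have hvu : ⟪u, v⟫ = 0 := by rw [real_inner_comm]; exact huv
  have hqv : q = p + ℓ • v := by
    rw [hvdef, smul_inv_smul₀ hℓ.ne']
    abel
  clear_value o v k
  have hcap : ∀ x ∈ C, α ≤ ⟪x, u⟫ → ‖x - o‖ ≤ 2 * k := by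
    intro x hx hxα
    refine norm_sub_le_of_mem_cap hC hconv ha hb hdiam hu hv huv
      (hside a (left_mem_segment ℝ a b)) (hside b (right_mem_segment ℝ a b)) hk ?_ ?_ hx hxα
    · simp [hodef, inner_add_left, inner_smul_left, huv, hp.2, hu]
    · intro z hz hzα
      have hz' : z ∈ segment ℝ p q := hpq ▸ ⟨hz, hzα⟩
      rw [segment_eq_image'] at hz'
      obtain ⟨t, ⟨ht0, ht1⟩, rfl⟩ := hz'
      have : p + t • (q - p) - o = (t * ℓ - √3 * k) • v - k • u := by
        rw [hodef, hqv]
        module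
      rw [this, inner_sub_left, inner_smul_left, inner_smul_left, hvu,
        real_inner_self_eq_norm_sq, hv, abs_le]
      simp only [conj_trivial]
      constructor <;> nlinarith
  obtain ⟨π, hπ, hπK⟩ := exists_lipschitzWith_one_projection
    (show (C ∩ {x | α ≤ ⟪x, u⟫}).Nonempty from ⟨p, hp.1, hp.2.ge⟩) hKc.isComplete hconvK
  have hfix : ∀ y ∈ C, α ≤ ⟪y, u⟫ → π y = y := by
    intro y hy hyα
    have := (hπK y).2 y ⟨hy, hyα⟩
    rw [real_inner_self_nonpos, sub_eq_zero] at this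
    exact this.symm
  have hinterior : ∀ y, π y ∈ interior C → ∀ w, α ≤ ⟪π y + w, u⟫ → ∃ t : ℝ, 0 < t ∧
      π y + t • w ∈ C ∩ {x | α ≤ ⟪x, u⟫} := by
    intro y hy w hw
    have hcont : Filter.Tendsto (fun t : ℝ ↦ π y + t • w) (nhdsWithin 0 (Set.Ioi 0))
        (nhds (π y)) := by
      have : Continuous fun t : ℝ ↦ π y + t • w := by fun_prop
      simpa using (this.tendsto 0).mono_left nhdsWithin_le_nhds
    obtain ⟨t, htC, ht⟩ := ((hcont.eventually (mem_interior_iff_mem_nhds.1 hy)).and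
      (Ioo_mem_nhdsGT (zero_lt_one' ℝ))).exists
    refine ⟨t, ht.1, htC, ?_⟩
    have h1 := (hπK y).1.2
    simp only [Set.mem_ofPred_eq, inner_add_left, inner_smul_left, conj_trivial] at h1 hw ⊢
    nlinarith [ht.1, ht.2]
  set Γ : ℝ → Plane := fun t ↦
    circlePath o v u (2 * k) (7 * Real.pi / 6 - 4 * Real.pi / 3 * t) with hΓ
  have hΓ0 : Γ 0 = p := by
    have h1 : 7 * Real.pi / 6 - 4 * Real.pi / 3 * 0 = Real.pi / 6 + Real.pi := by ring
    simp only [hΓ, circlePath, h1, Real.cos_add_pi, Real.sin_add_pi, Real.cos_pi_div_six,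
      Real.sin_pi_div_six, hodef]
    module
  have hΓ1 : Γ 1 = q := by
    have h1 : 7 * Real.pi / 6 - 4 * Real.pi / 3 * 1 = -(Real.pi / 6) := by ring
    simp only [hΓ, circlePath, h1, Real.cos_neg, Real.sin_neg, Real.cos_pi_div_six,
      Real.sin_pi_div_six, hodef]
    rw [hqv, ← hkℓ]
    module
  have hΓu : ∀ t ∈ Set.Icc (0 : ℝ) 1, α ≤ ⟪Γ t, u⟫ := by
    intro t ht
    have hsin : -(1 / 2) ≤ Real.sin (7 * Real.pi / 6 - 4 * Real.pi / 3 * t) := by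
      have h1 : Real.sin (7 * Real.pi / 6 - 4 * Real.pi / 3 * t)
          = Real.cos (4 * Real.pi / 3 * t - 2 * Real.pi / 3) := by
        rw [← Real.cos_pi_div_two_sub]
        congr 1
        ring
      have h2 : Real.cos (2 * Real.pi / 3) = -(1 / 2) := by
        rw [show 2 * Real.pi / 3 = Real.pi - Real.pi / 3 by ring, Real.cos_pi_sub,
          Real.cos_pi_div_three]
      rw [h1, ← h2, ← Real.cos_abs (4 * Real.pi / 3 * t - 2 * Real.pi / 3)]
      have hpi := Real.pi_pos
      apply Real.cos_le_cos_of_nonneg_of_le_pi (abs_nonneg _) (by linarith)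
      rw [abs_le]
      constructor <;> nlinarith [ht.1, ht.2]
    simp only [hΓ, circlePath, hodef, inner_add_left, inner_smul_left, huv, hp.2,
      real_inner_self_eq_norm_sq, hu, conj_trivial]
    nlinarith
  have hLip : LipschitzWith (2 * k * (4 * Real.pi / 3)).toNNReal (π ∘ Γ) := by
    refine LipschitzWith.of_dist_le_mul fun s t ↦ (hπ.dist_le_mul _ _).trans ?_
    rw [Real.coe_toNNReal _ (by positivity), NNReal.coe_one, one_mul]
    refine (circlePath_dist_le hu hv huv o (by positivity) _ _).trans_eq ?_
    rw [mul_assoc (2 * k)]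
    congr 1
    rw [Real.dist_eq, Real.dist_eq, _root_.sub_sub_sub_cancel_left, ← mul_sub, abs_mul,
      abs_of_pos (by positivity), abs_sub_comm]
  have hlen : pathLen (π ∘ Γ) ≤ ENNReal.ofReal (4 * Real.pi * √3 / 9 * ℓ) := by
    have h1 := hLip.lipschitzOnWith (s := Set.univ) |>.comp_eVariationOn_le
      (g := fun t : ℝ ↦ t) (s := Set.Icc 0 1) (fun _ _ ↦ Set.mem_univ _)
    have h2 : eVariationOn (fun t : ℝ ↦ t) (Set.Icc 0 1) = ENNReal.ofReal 1 := by
      have := (monotone_id (α := ℝ)).monotoneOn (Set.Icc 0 1) |>.eVariationOn_eq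
        (a := 0) (b := 1) (by simp) (by simp)
      rwa [Set.inter_self, id, id, sub_zero] at this
    refine h1.trans_eq ?_
    rw [h2, ENNReal.ofReal_one, mul_one]
    change ENNReal.ofReal _ = _
    congr 1
    rw [hkdef]
    ring
  refine ⟨π ∘ Γ, hLip.continuous.continuousOn, ?_, ?_, ?_, hlen, hlen.trans_lt ?_⟩
  · rw [Function.comp_apply, hΓ0, hfix p hp.1 hp.2.ge]
  · rw [Function.comp_apply, hΓ1, hfix q hq.1 hq.2.ge]
  · intro t ht
    refine ⟨⟨subset_closure (hπK _).1.1, fun hmem ↦ ?_⟩, (hπK _).1.2⟩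
    simp only [Function.comp_apply] at hmem
    have hfixt : π (Γ t) = Γ t := by
      obtain ⟨r, hr, hrK⟩ := hinterior _ hmem (Γ t - π (Γ t))
        (by rw [add_sub_cancel]; exact hΓu t ht)
      have h1 := (hπK (Γ t)).2 _ hrK
      rw [add_sub_cancel_left, inner_smul_right] at h1
      have h2 := real_inner_self_nonpos.1 (nonpos_of_mul_nonpos_right h1 hr)
      exact (sub_eq_zero.1 h2).symm
    -- Moving from `Γ t` along the tangent to the circle leaves the disk.
    set θ := 7 * Real.pi / 6 - 4 * Real.pi / 3 * t with hθ
    obtain ⟨σ, hσ, hσcos⟩ : ∃ σ : ℝ, σ ^ 2 = 1 ∧ 0 ≤ σ * Real.cos θ := by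
      rcases le_total 0 (Real.cos θ) with h | h
      · exact ⟨1, by norm_num, by linarith⟩
      · exact ⟨-1, by norm_num, by linarith⟩
    obtain ⟨r, hr, hrC, hrα⟩ := hinterior _ hmem
      ((-(σ * Real.sin θ)) • v + (σ * Real.cos θ) • u) (by
        rw [inner_add_left, hfixt]
        simp only [inner_add_left, inner_smul_left, huv, real_inner_self_eq_norm_sq, hu,
          conj_trivial]
        linarith [hΓu t ht])
    have hout := hcap _ hrC hrα
    rw [hfixt, ← sq_le_sq₀ (norm_nonneg _) (by positivity),
      Plane.norm_sq_eq_of_orthonormal hu hv huv] at hout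
    have heq : Γ t + r • ((-(σ * Real.sin θ)) • v + (σ * Real.cos θ) • u) - o
        = (2 * k * Real.cos θ - r * σ * Real.sin θ) • v
          + (2 * k * Real.sin θ + r * σ * Real.cos θ) • u := by
      simp only [hΓ, circlePath, ← hθ]
      module
    rw [heq] at hout
    simp only [inner_add_left, inner_smul_left, huv, hvu, real_inner_self_eq_norm_sq, hu, hv,
      conj_trivial] at hout
    have hsc := Real.sin_sq_add_cos_sq θ
    have hexp : (2 * k * Real.cos θ - r * σ * Real.sin θ) ^ 2
        + (2 * k * Real.sin θ + r * σ * Real.cos θ) ^ 2 = (2 * k) ^ 2 + r ^ 2 := by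
      linear_combination (4 * k ^ 2 + r ^ 2 * σ ^ 2) * hsc + r ^ 2 * hσ
    nlinarith [pow_pos hr 2]
  · rw [ENNReal.ofReal_lt_ofReal_iff (by positivity)]
    have h4 : √3 < 1.7321 := by
      rw [Real.sqrt_lt' (by norm_num)]
      norm_num
    have h5 := Real.pi_lt_d4
    have h6 : 4 * Real.pi * √3 / 9 < 2.42 := by
      nlinarith [Real.pi_pos, Real.sqrt_nonneg 3]
    exact mul_lt_mul_of_pos_right h6 hℓ
end
end
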